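/- arXiv:2005.09012 — 3 statements merged into one kernel-verified Lean document; each statement's English description precedes it below -/
import Mathlib

section
/- If N_{μ,ν,λ} > 0 and |λ| > |μ Δ ν|, then there exists a partition λ'' ⊂ λ with |λ''| = |λ| − 2 such that N_{μ,ν,λ''} > 0. -/
open YoungDiagram

/-- An LR (Littlewood–Richardson) filling witnessing the Littlewood–Richardson
coefficient `c^lam_{μ,ν}`: a ballot (lattice-word) semistandard filling of the skew
shape `lam/μ` with content `ν`.  The entry in row `i`, column `j` is `T i j`;
entries are `≥ 1` on the cells of `lam/μ` and `0` elsewhere. -/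
structure LRFilling (μ ν lam : YoungDiagram) : Type where
  sub : μ ≤ lam
  T : ℕ → ℕ → ℕ
  supp : ∀ i j, T i j ≠ 0 ↔ ((i, j) ∈ lam ∧ (i, j) ∉ μ)
  rows_weak : ∀ i j₁ j₂, j₁ ≤ j₂ → T i j₁ ≠ 0 → T i j₂ ≠ 0 → T i j₁ ≤ T i j₂
  cols_strict : ∀ i₁ i₂ j, i₁ < i₂ → T i₁ j ≠ 0 → T i₂ j ≠ 0 → T i₁ j < T i₂ j
  content : ∀ k : ℕ, Nat.card {p : ℕ × ℕ // T p.1 p.2 = k + 1} = ν.rowLen k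
  ballot : ∀ i j k : ℕ,
    Nat.card {p : ℕ × ℕ // (p.1 < i ∨ (p.1 = i ∧ j ≤ p.2)) ∧ T p.1 p.2 = k + 2} ≤
      Nat.card {p : ℕ × ℕ // (p.1 < i ∨ (p.1 = i ∧ j ≤ p.2)) ∧ T p.1 p.2 = k + 1}

/-- The Littlewood–Richardson coefficient `c^lam_{μ,ν}`. -/
noncomputable def lrCoeff (μ ν lam : YoungDiagram) : ℕ := Nat.card (LRFilling μ ν lam)

/-- The Newell–Littlewood number
`N_{μ,ν,lam} = Σ_{α,β,γ} c^μ_{α,β} c^ν_{α,γ} c^lam_{β,γ}`,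
realized as the cardinality of the set of triples of LR fillings over all `α,β,γ`. -/
noncomputable def NL (μ ν lam : YoungDiagram) : ℕ :=
  Nat.card (Σ α β γ : YoungDiagram,
    (LRFilling α β μ × LRFilling α γ ν × LRFilling β γ lam))
structure IsHive (b c l : ℕ → ℤ) (h : ℕ → ℕ → ℤ) : Prop where
  z : ∀ k, h 0 k = 0
  hb : ∀ r, h (r+1) 0 - h r 0 = b r
  hl : ∃ N, ∀ k, N ≤ k → ∀ r, h (r+1) k - h r k = l r
  hc : ∃ N, ∀ r, N ≤ r → ∀ k, h r (k+1) - h r k = c k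
  ha : ∀ r k, h (r+1) k - h r k ≤ h (r+1) (k+1) - h r (k+1)
  hcol : ∀ r k, h (r+2) (k+1) - h (r+1) (k+1) ≤ h (r+1) k - h r k
  hbal : ∀ r k, h (r+1) (k+2) - h (r+1) (k+1) ≤ h r (k+1) - h r k

theorem IsHive.l_anti {b c l h} (H : IsHive b c l h) (r : ℕ) : l (r+1) ≤ l r := by
  obtain ⟨N, hN⟩ := H.hl
  have h1 := hN (N+1) (by omega) (r+1)
  have h2 := hN N le_rfl r
  have := H.hcol r N
  rw [← h1, ← h2]; exact this

theorem IsHive.c_anti {b c l h} (H : IsHive b c l h) (k : ℕ) : c (k+1) ≤ c k := by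
  obtain ⟨N, hN⟩ := H.hc
  have h1 := hN (N+1) (by omega) (k+1)
  have h2 := hN N le_rfl k
  have := H.hbal N k
  rw [← h1, ← h2]; exact this

theorem IsHive.mono {b c l h} (H : IsHive b c l h) (r : ℕ) :
    Monotone (fun k => h (r+1) k - h r k) := monotone_nat_of_le_succ (fun k => H.ha r k)

theorem IsHive.l_ge {b c l h} (H : IsHive b c l h) (r k : ℕ) : h (r+1) k - h r k ≤ l r := by
  obtain ⟨N, hN⟩ := H.hl
  have := H.mono r (le_max_left k N)
  simp only at this
  rwa [hN _ (le_max_right _ _)] at this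

theorem IsHive.b_le {b c l h} (H : IsHive b c l h) (r k : ℕ) : b r ≤ h (r+1) k - h r k := by
  have := H.mono r (Nat.zero_le k)
  simp only at this
  rwa [H.hb] at this

theorem IsHive.C_mono {b c l h} (H : IsHive b c l h) (k : ℕ) :
    Monotone (fun r => h r (k+1) - h r k) :=
  monotone_nat_of_le_succ (fun r => by have := H.ha r k; show h r (k+1) - h r k ≤ h (r+1) (k+1) - h (r+1) k; omega)

theorem IsHive.c_ge {b c l h} (H : IsHive b c l h) (r k : ℕ) : h r (k+1) - h r k ≤ c k := by
  obtain ⟨N, hN⟩ := H.hc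
  have := H.C_mono k (le_max_left r N)
  simp only at this
  rwa [hN _ (le_max_right _ _)] at this

theorem IsHive.C_nonneg {b c l h} (H : IsHive b c l h) (r k : ℕ) : 0 ≤ h r (k+1) - h r k := by
  have := H.C_mono k (Nat.zero_le r)
  simp only [H.z] at this
  omega

open Classical in
/-- sliding path -/
noncomputable def slideP (h : ℕ → ℕ → ℤ) (i : ℕ) : ℕ → ℕ
  | 0 => i
  | k+1 => if h (slideP h i k + 2) (k+1) - h (slideP h i k + 1) (k+1)
        = h (slideP h i k + 1) k - h (slideP h i k) k then slideP h i k + 1 else slideP h i k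

theorem IsHive.slide {b c l h} (H : IsHive b c l h) (i : ℕ) (hi : b (i+1) < b i) :
    ∃ j h', IsHive (fun r => b r - if r = i then 1 else 0) c (fun r => l r - if r = j then 1 else 0) h' := by
  set p := slideP h i with hp
  have p0 : p 0 = i := rfl
  have ps : ∀ k, (p (k+1) = p k + 1 ∧ h (p k + 2) (k+1) - h (p k + 1) (k+1) = h (p k + 1) k - h (p k) k)
     ∨ (p (k+1) = p k ∧ h (p k + 2) (k+1) - h (p k + 1) (k+1) < h (p k + 1) k - h (p k) k) := by
    intro k
    have e : p (k+1) = if h (p k + 2) (k+1) - h (p k + 1) (k+1)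
        = h (p k + 1) k - h (p k) k then p k + 1 else p k := by rw [hp, slideP]
    have := H.hcol (p k) k
    split_ifs at e <;> omega
  have inv : ∀ k, h (p k + 2) k - h (p k + 1) k < h (p k + 1) k - h (p k) k := by
    intro k
    induction k with
    | zero => rw [p0]; have := H.hb i; have := H.hb (i+1); simp only [add_assoc] at *; norm_num at *; omega
    | succ k ih =>
      rcases ps k with ⟨e, t⟩ | ⟨e, t⟩
      · rw [e]
        have := H.hcol (p k + 1) k
        simp only [add_assoc] at *; norm_num at *; omega
      · rw [e]
        have := H.ha (p k) k
        omega
  obtain ⟨N, hN⟩ := H.hl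
  have pc : ∀ k, p (N + k) = p N := by
    intro k
    induction k with
    | zero => rfl
    | succ k ih =>
      rcases ps (N+k) with ⟨e, t⟩ | ⟨e, t⟩
      · have h1 := inv (N+k)
        have h2 := hN (N+k) (by omega) (p (N+k) + 1)
        have h3 := hN (N+k+1) (by omega) (p (N+k) + 1)
        simp only [add_assoc] at *; norm_num at *; omega
      · rw [← ih]; exact e
  have pm : Monotone p := monotone_nat_of_le_succ (fun k => by rcases ps k with h | h <;> omega)
  have pb : ∀ k, p k ≤ p N := by
    intro k
    have := pm (show k ≤ N + k by omega)
    rwa [pc] at this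
  refine ⟨p N, fun r k => h r k - if p k < r then 1 else 0, ?_, ?_, ?_, ?_, ?_, ?_, ?_⟩
  · intro k; simp [H.z]
  · intro r; have := H.hb r; rw [p0]; split_ifs <;> omega
  · refine ⟨N, fun k hk r => ?_⟩
    obtain ⟨d, rfl⟩ := Nat.exists_eq_add_of_le hk
    rw [pc]
    have := hN _ hk r
    split_ifs <;> omega
  · obtain ⟨M, hM⟩ := H.hc
    refine ⟨max M (p N + 1), fun r hr k => ?_⟩
    have := hM r (by omega) k
    have := pb k
    have := pb (k+1)
    split_ifs <;> omega
  · intro r k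
    have h1 := H.ha r k
    have h2 := ps k
    have h3 := inv k
    by_cases e : r = p k + 1
    · subst e
      simp only [add_assoc] at *; norm_num at *
      split_ifs <;> omega
    · split_ifs <;> omega
  · intro r k
    have h1 := H.hcol r k
    have h2 := ps k
    by_cases e : r = p k
    · subst e
      split_ifs <;> omega
    · split_ifs <;> omega
  · intro r k
    have h1 := H.hbal r k
    by_cases e : r = p k ∧ p (k+1) = p k ∧ p (k+2) = p k + 1
    · obtain ⟨rfl, e2, e3⟩ := e
      have h2 := ps k
      have h3 := ps (k+1)
      have h4 := H.hbal (p k + 1) k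
      simp only [e2, add_assoc] at *; norm_num at *
      split_ifs <;> omega
    · have h2 := ps k
      have h3 := ps (k+1)
      have e3 : k + 1 + 1 = k + 2 := rfl
      rw [e3] at *
      split_ifs <;> omega

theorem IsHive.cornerStep {b c l h} (H : IsHive b c l h) (k : ℕ) : ∀ g : ℕ,
    h (g+1) (k+2) - h (g+1) (k+1) < h g (k+1) - h g k →
    ∃ s < g, h (s+1) k - h s k < h (s+1) (k+1) - h s (k+1) ∧
      h (s+2) (k+2) - h (s+1) (k+2) < h (s+1) (k+1) - h s (k+1) ∧
      ∀ r, s < r → r ≤ g → h (r+1) (k+2) - h (r+1) (k+1) < h r (k+1) - h r k := by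
  intro g
  induction g with
  | zero =>
    intro hg
    have h1 := H.C_nonneg 1 (k+1)
    have h2 := H.z k
    have h3 := H.z (k+1)
    have e3 : k + 1 + 1 = k + 2 := rfl
    rw [e3] at *
    norm_num at *
    omega
  | succ g ih =>
    intro hg
    by_cases hs : h (g+1) k - h g k < h (g+1) (k+1) - h g (k+1) ∧
      h (g+2) (k+2) - h (g+1) (k+2) < h (g+1) (k+1) - h g (k+1)
    · refine ⟨g, by omega, hs.1, hs.2, ?_⟩
      intro r h1 h2
      obtain rfl : r = g + 1 := by omega
      exact hg
    · have a1 := H.ha g k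
      have a2 := H.ha (g+1) (k+1)
      have c1 := H.hcol g k
      have c2 := H.hcol g (k+1)
      have e3 : k + 1 + 1 = k + 2 := rfl
      have e4 : g + 1 + 1 = g + 2 := rfl
      rw [e3] at *
      rw [e4] at *
      obtain ⟨s, s1, s2, s3, s4⟩ := ih (by omega)
      refine ⟨s, by omega, s2, s3, ?_⟩
      intro r h1 h2
      by_cases hr : r = g + 1
      · subst hr; exact hg
      · exact s4 r h1 (by omega)

theorem IsHive.cornerStep2 {b c l h} (H : IsHive b c l h) (k g : ℕ)
    (hg : h (g+2) (k+1) - h (g+1) (k+1) < h (g+1) k - h g k) :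
    ∃ s ≤ g, (s ≠ g → h (s+1) k - h s k < h (s+1) (k+1) - h s (k+1)) ∧
      h (s+2) (k+2) - h (s+1) (k+2) < h (s+1) (k+1) - h s (k+1) ∧
      ∀ r, s < r → r ≤ g → h (r+1) (k+2) - h (r+1) (k+1) < h r (k+1) - h r k := by
  by_cases hs : h (g+2) (k+2) - h (g+1) (k+2) < h (g+1) (k+1) - h g (k+1)
  · exact ⟨g, le_rfl, by simp, hs, by intros; omega⟩
  · have c2 := H.hcol g (k+1)
    have b2 := H.hbal (g+1) k
    have e3 : k + 1 + 1 = k + 2 := rfl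
    have e4 : g + 1 + 1 = g + 2 := rfl
    rw [e3] at *
    rw [e4] at *
    obtain ⟨s, s1, s2, s3, s4⟩ := H.cornerStep k g (by omega)
    exact ⟨s, s1.le, fun _ => s2, s3, s4⟩

theorem IsHive.remContent {b c l h} (H : IsHive b c l h) (y : ℕ) (hy : c (y+1) < c y) :
    ∃ j h', IsHive b (fun k => c k - if k = y then 1 else 0)
      (fun r => l r - if r = j then 1 else 0) h' := by
  obtain ⟨M, hM⟩ := H.hc
  obtain ⟨s0, s1, s2, s3, s4⟩ := H.cornerStep y M (by
    rw [hM M le_rfl, hM (M+1) (by omega) (y+1)]; exact hy)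
  have s5 : ∀ r, s0 < r → h (r+1) (y+2) - h (r+1) (y+1) < h r (y+1) - h r y := by
    intro r hr
    by_cases hrM : r ≤ M
    · exact s4 r hr hrM
    · rw [hM r (by omega), hM (r+1) (by omega) (y+1)]; exact hy
  choose! f f1 f2 f3 f4 using H.cornerStep2
  let G : ℕ → ℕ := fun n => Nat.rec (motive := fun _ => ℕ) s0 (fun m g => f (y+1+m) g) n
  have G0 : G 0 = s0 := rfl
  have GS : ∀ n, G (n+1) = f (y+1+n) (G n) := fun n => rfl
  have Ginv : ∀ n, h (G n+2) (y+1+n+1) - h (G n+1) (y+1+n+1) < h (G n+1) (y+1+n) - h (G n) (y+1+n) := by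
    intro n
    induction n with
    | zero => rw [G0]; exact s3
    | succ n ih => rw [GS]; exact f3 _ _ ih
  let g : ℕ → ℕ := fun k => G (k - (y+1))
  have g0 : g (y+1) = s0 := by simp [g, G0]
  have key : ∀ k, y < k → ∃ n, k = y+1+n := fun k hk => ⟨k-(y+1), by omega⟩
  have gG : ∀ n, g (y+1+n) = G n := by intro n; simp [g]
  have gS : ∀ k, y < k → g (k+1) = f k (g k) := by
    intro k hk
    obtain ⟨n, rfl⟩ := key k hk
    rw [gG, add_assoc, gG, GS]
  have ginv : ∀ k, y < k → h (g k+2) (k+1) - h (g k+1) (k+1) < h (g k+1) k - h (g k) k := by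
    intro k hk
    obtain ⟨n, rfl⟩ := key k hk
    rw [gG]; exact Ginv n
  have gle : ∀ k, y < k → g (k+1) ≤ g k := fun k hk => by rw [gS k hk]; exact f1 _ _ (ginv k hk)
  have ga : ∀ k, y < k → g (k+1) ≠ g k →
      h (g (k+1)+1) k - h (g (k+1)) k < h (g (k+1)+1) (k+1) - h (g (k+1)) (k+1) := fun k hk => by
    rw [gS k hk]; exact f2 _ _ (ginv k hk)
  have gb : ∀ k, y < k → ∀ r, g (k+1) < r → r ≤ g k →
      h (r+1) (k+2) - h (r+1) (k+1) < h r (k+1) - h r k := fun k hk => by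
    rw [gS k hk]; exact f4 _ _ (ginv k hk)
  have Gan : Antitone G := antitone_nat_of_succ_le (fun n => by rw [GS]; exact f1 _ _ (Ginv n))
  obtain ⟨N, hN⟩ : ∃ N, ∀ n, N ≤ n → G n = G N := by
    have hex : ∃ v, ∃ n, G n = v := ⟨_, 0, rfl⟩
    classical
    obtain ⟨N, hN⟩ := Nat.find_spec hex
    refine ⟨N, fun n hn => le_antisymm (Gan hn) ?_⟩
    rw [hN]; exact Nat.find_min' hex ⟨n, rfl⟩
  have gN : ∀ k, y + 1 + N ≤ k → g k = G N := by
    intro k hk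
    obtain ⟨n, rfl⟩ := key k (by omega)
    rw [gG]; exact hN n (by omega)
  have gmax : ∀ k, g k ≤ s0 := fun k => Gan (Nat.zero_le _)
  clear_value g
  refine ⟨G N, fun (r k : ℕ) => h r k - if y < k ∧ g k < r then 1 else 0, ?_, ?_, ?_, ?_, ?_, ?_, ?_⟩
  · intro k; simp [H.z]
  · intro r; simp [H.hb]
  · obtain ⟨K, hK⟩ := H.hl
    refine ⟨max K (y+1+N), fun k hk r => ?_⟩
    have := hK k (by omega) r
    have := gN k (by omega)
    split_ifs <;> omega
  · refine ⟨max M (s0+1), fun r hr k => ?_⟩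
    have := hM r (by omega) k
    have := gmax k
    have := gmax (k+1)
    split_ifs <;> omega
  · intro r k
    have h1 := H.ha r k
    rcases lt_trichotomy k y with hk | rfl | hk
    · split_ifs <;> omega
    · rw [g0]
      by_cases e : r = s0
      · subst e; split_ifs <;> omega
      · split_ifs <;> omega
    · have h2 := ga k hk
      have h3 := gle k hk
      by_cases e : r = g (k+1)
      · subst e; split_ifs <;> omega
      · split_ifs <;> omega
  · intro r k
    have h1 := H.hcol r k
    by_cases hk : y < k
    · have h2 := ginv k hk
      have h3 := gle k hk
      by_cases e : r = g k
      · subst e; split_ifs <;> omega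
      · split_ifs <;> omega
    · by_cases e : k = y
      · subst e
        split_ifs <;> omega
      · split_ifs <;> omega
  · intro r k
    have h1 := H.hbal r k
    rcases lt_trichotomy k y with hk | rfl | hk
    · by_cases e : k + 1 = y
      · subst e
        split_ifs <;> omega
      · split_ifs <;> omega
    · rw [g0]
      have h2 := s5 r
      have h3 := gle (k+1) (by omega)
      rw [g0] at h3
      have e3 : k + 1 + 1 = k + 2 := rfl
      rw [e3] at *
      split_ifs <;> omega
    · have h2 := gb k hk r
      have h3 := gle k hk
      have h4 := gle (k+1) (by omega)
      have e3 : k + 1 + 1 = k + 2 := rfl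
      rw [e3] at *
      split_ifs <;> omega

open Classical in
/-- the path used when a box is added to the inner shape -/
noncomputable def addP (h : ℕ → ℕ → ℤ) (i : ℕ) : ℕ → ℕ
  | 0 => i
  | k+1 =>
    if h (addP h i k + 1) k - h (addP h i k) k = h (addP h i k + 1) (k+1) - h (addP h i k) (k+1)
    then addP h i k
    else if hx : ∃ r, addP h i k < r ∧ h (r+1) (k+2) - h (r+1) (k+1) = h r (k+1) - h r k
      then Nat.find hx else 0

theorem IsHive.addInner {b c l h} (H : IsHive b c l h) (i : ℕ) (hi : ∀ r, r + 1 = i → b i < b r)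
    (hil : b i < l i) (hc0 : ∃ M, ∀ k, M ≤ k → c k = 0) :
    ∃ j h', IsHive (fun r => b r + if r = i then 1 else 0)
      (fun k => c k - if k = j then 1 else 0) l h' := by
  classical
  set q := addP h i with hq
  have q0 : q 0 = i := rfl
  have qs1 : ∀ k, h (q k + 1) k - h (q k) k = h (q k + 1) (k+1) - h (q k) (k+1) → q (k+1) = q k := by
    intro k hk
    show addP h i (k+1) = addP h i k
    rw [addP, if_pos hk]
  have qs2 : ∀ k, h (q k + 1) k - h (q k) k < h (q k + 1) (k+1) - h (q k) (k+1) →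
      (∃ r, q k < r ∧ h (r+1) (k+2) - h (r+1) (k+1) = h r (k+1) - h r k) →
      q k < q (k+1) ∧ h (q (k+1)+1) (k+2) - h (q (k+1)+1) (k+1) = h (q (k+1)) (k+1) - h (q (k+1)) k ∧
      ∀ r, q k < r → r < q (k+1) → h (r+1) (k+2) - h (r+1) (k+1) < h r (k+1) - h r k := by
    intro k hk hx
    have e : q (k+1) = Nat.find hx := by
      show addP h i (k+1) = _
      rw [addP, if_neg hk.ne, dif_pos hx]
    have sp := Nat.find_spec hx
    rw [← e] at sp
    refine ⟨sp.1, sp.2, fun r h1 h2 => ?_⟩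
    rw [e] at h2
    have := Nat.find_min hx h2
    have := H.hbal r k
    by_contra hcon
    exact Nat.find_min hx h2 ⟨h1, by omega⟩
  -- first letter in row i
  have hx : ∃ k, h (i + 1) k - h i k < h (i + 1) (k+1) - h i (k+1) := by
    by_contra hcon
    push Not at hcon
    have : ∀ k, h (i+1) k - h i k ≤ b i := by
      intro k
      induction k with
      | zero => rw [H.hb]
      | succ k ih => exact (hcon k).trans ih
    obtain ⟨N, hN⟩ := H.hl
    have h1 := this N
    rw [hN N le_rfl] at h1
    omega
  set x := Nat.find hx with hxdef
  have hx1 := Nat.find_spec hx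
  have hx2 : ∀ k, k < x → h (i + 1) k - h i k = h (i + 1) (k+1) - h i (k+1) := fun k hk => by
    have h1 := Nat.find_min hx hk
    have h2 := H.ha i k
    omega
  have qx : ∀ k, k ≤ x → q k = i := by
    intro k
    induction k with
    | zero => intro _; exact q0
    | succ k ih =>
      intro hk
      have e := ih (by omega)
      rw [qs1 k (by rw [e]; exact hx2 k (by omega)), e]
  have bx : ∀ k, k ≤ x → h (i+1) k - h i k = b i := by
    intro k
    induction k with
    | zero => intro _; exact H.hb i
    | succ k ih =>
      intro hk
      rw [← ih (by omega), hx2 k (by omega)]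
  let Ex : ℕ → Prop := fun k => ∃ r, q k < r ∧ h (r+1) (k+2) - h (r+1) (k+1) = h r (k+1) - h r k
  have pos : ∀ n, (∀ m < n, Ex (x+m)) →
      h (q (x+n) + 1) (x+n) - h (q (x+n)) (x+n) < h (q (x+n) + 1) (x+n+1) - h (q (x+n)) (x+n+1) := by
    intro n
    induction n with
    | zero => intro _; simp only [add_zero]; rw [qx x le_rfl]; exact hx1
    | succ n ih =>
      intro hE
      have p := ih (fun m hm => hE m (by omega))
      obtain ⟨t1, t2, t3⟩ := qs2 (x+n) p (hE n (by omega))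
      show h (q (x+n+1) + 1) (x+n+1) - h (q (x+n+1)) (x+n+1) < h (q (x+n+1) + 1) (x+n+2) - h (q (x+n+1)) (x+n+2)
      generalize x + n = k at *
      obtain ⟨r, hr⟩ : ∃ r, q (k+1) = r + 1 := ⟨q (k+1) - 1, by omega⟩
      rw [hr] at t1 t2 t3 ⊢
      have h2 := H.ha r k
      have h3 := H.hbal r k
      by_cases e : r = q k
      · subst e; omega
      · have := t3 r (by omega) (by omega)
        omega
  have hj : ∃ n, ¬ Ex (x+n) := by
    by_contra hcon
    push Not at hcon
    obtain ⟨M, hM⟩ := hc0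
    have h1 := pos M (fun m _ => hcon m)
    have h2 := H.c_ge (q (x+M) + 1) (x+M)
    have h3 := H.C_nonneg (q (x+M)) (x+M)
    rw [hM (x+M) (by omega)] at h2
    omega
  set n := Nat.find hj with hn
  have hn1 : ¬ Ex (x+n) := Nat.find_spec hj
  have hn2 : ∀ m, m < n → Ex (x+m) := fun m hm => by
    have := Nat.find_min hj hm
    exact not_not.mp this
  obtain ⟨j, hjd⟩ : ∃ j, j = x + n := ⟨_, rfl⟩
  have F1 : ∀ k, x ≤ k → k ≤ j → h (q k + 1) k - h (q k) k < h (q k + 1) (k+1) - h (q k) (k+1) := by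
    intro k h1 h2
    obtain ⟨m, rfl⟩ := Nat.exists_eq_add_of_le h1
    exact pos m (fun m' hm' => hn2 m' (by omega))
  have F2 : ∀ k, x ≤ k → k < j →  q k < q (k+1) ∧ h (q (k+1)+1) (k+2) - h (q (k+1)+1) (k+1) = h (q (k+1)) (k+1) - h (q (k+1)) k ∧
      ∀ r, q k < r → r < q (k+1) → h (r+1) (k+2) - h (r+1) (k+1) < h r (k+1) - h r k := by
    intro k h1 h2
    apply qs2 k (F1 k h1 h2.le)
    obtain ⟨m, rfl⟩ := Nat.exists_eq_add_of_le h1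
    exact hn2 m (by omega)
  have F3 : ∀ r, q j < r → h (r+1) (j+2) - h (r+1) (j+1) < h r (j+1) - h r j := by
    intro r hr
    have h1 := H.hbal r j
    by_contra hcon
    apply hn1
    rw [← hjd]
    exact ⟨r, hr, by omega⟩
  have xj : x ≤ j := by omega
  have qle : ∀ k, k < j → q k ≤ q (k+1) := by
    intro k hk
    by_cases hkx : k < x
    · rw [qx k hkx.le, qx (k+1) hkx]
    · exact (F2 k (by omega) hk).1.le
  have qmax : ∀ d k, k + d = j → q k ≤ q j := by
    intro d
    induction d with
    | zero => intro k hk; rw [← hk]; rfl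
    | succ d ih => intro k hk; exact (qle k (by omega)).trans (ih (k+1) (by omega))
  refine ⟨j, fun r k => h r k + if k ≤ j ∧ q k < r then 1 else 0, ?_, ?_, ?_, ?_, ?_, ?_, ?_⟩
  · intro k; simp [H.z]
  · intro r; have := H.hb r; rw [q0]; split_ifs <;> omega
  · obtain ⟨N, hN⟩ := H.hl
    refine ⟨max N (j+1), fun k hk r => ?_⟩
    have := hN k (by omega) r
    split_ifs <;> omega
  · obtain ⟨M, hM⟩ := H.hc
    refine ⟨max M (q j + 1), fun r hr k => ?_⟩
    have h1 := hM r (by omega) k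
    have h2 := qmax (j-k) k
    have h3 := qmax (j-(k+1)) (k+1)
    split_ifs <;> omega
  · intro r k
    have h1 := H.ha r k
    by_cases hkj : k ≤ j
    · by_cases hkx : k < x
      · have h2 := qx k hkx.le
        have h3 := qx (k+1) hkx
        split_ifs <;> omega
      · have h2 := F1 k (by omega) hkj
        by_cases e : r = q k
        · subst e; split_ifs <;> omega
        · split_ifs <;> omega
    · split_ifs <;> omega
  · intro r k
    have h1 := H.hcol r k
    by_cases hkj : k < j
    · by_cases hkx : k < x
      · have h2 := qx k hkx.le
        have h3 := qx (k+1) hkx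
        by_cases e : r + 1 = i
        · have h4 := hi r e
          have h5 := bx (k+1) (by omega)
          have h6 := H.b_le r k
          subst e
          have e4 : r + 1 + 1 = r + 2 := rfl
          rw [e4] at *
          split_ifs <;> omega
        · split_ifs <;> omega
      · obtain ⟨t1, t2, t3⟩ := F2 k (by omega) hkj
        by_cases e : q (k+1) = r + 1 ∧ q k < r
        · have h2 := t3 r e.2 (by omega)
          rw [e.1] at t2
          have h3 := H.hcol r (k+1)
          have e3 : k + 1 + 1 = k + 2 := rfl
          have e4 : r + 1 + 1 = r + 2 := rfl
          rw [e4] at *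
          rw [e3] at *
          rw [e.1]
          split_ifs <;> omega
        · split_ifs <;> omega
    · split_ifs <;> omega
  · intro r k
    have h1 := H.hbal r k
    by_cases hkj : k ≤ j
    · by_cases hkj2 : k = j
      · subst hkj2
        have h2 := F3 r
        split_ifs <;> omega
      · by_cases hkx : k < x
        · have h2 := qx k hkx.le
          have h3 := qx (k+1) hkx
          have h4 := qle (k+1)
          have e3 : k + 1 + 1 = k + 2 := rfl
          rw [e3] at *
          split_ifs <;> omega
        · obtain ⟨t1, t2, t3⟩ := F2 k (by omega) (by omega)
          have h2 := t3 r
          have h5 := F2 (k+1) (by omega)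
          have h6 := F3 r
          have e3 : k + 1 + 1 = k + 2 := rfl
          rw [e3] at *
          by_cases e : k + 1 = j
          · subst e
            split_ifs <;> omega
          · have h7 := (h5 (by omega)).1
            split_ifs <;> omega
    · split_ifs <;> omega

/-- row lengths as integers -/
def rl (μ : YoungDiagram) : ℕ → ℤ := fun r => (μ.rowLen r : ℤ)

/-- counting cells in the first rows with small entries -/
def cntH (lam : YoungDiagram) (T : ℕ → ℕ → ℕ) (r k : ℕ) : ℤ :=
  ((lam.cells.filter (fun p => p.1 < r ∧ T p.1 p.2 ≤ k)).card : ℤ)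

theorem cntH_row (lam : YoungDiagram) (T : ℕ → ℕ → ℕ) (r k : ℕ) :
    cntH lam T (r+1) k - cntH lam T r k =
      ((lam.cells.filter (fun p => p.1 = r ∧ T p.1 p.2 ≤ k)).card : ℤ) := by
  unfold cntH
  have : lam.cells.filter (fun p => p.1 < r+1 ∧ T p.1 p.2 ≤ k) =
      lam.cells.filter (fun p => p.1 < r ∧ T p.1 p.2 ≤ k) ∪
      lam.cells.filter (fun p => p.1 = r ∧ T p.1 p.2 ≤ k) := by
    ext p; simp only [Finset.mem_filter, Finset.mem_union]; grind
  rw [this, Finset.card_union_of_disjoint]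
  · push_cast; ring
  · rw [Finset.disjoint_left]; intro p; simp only [Finset.mem_filter]; grind

theorem cntH_col (lam : YoungDiagram) (T : ℕ → ℕ → ℕ) (r k : ℕ) :
    cntH lam T r (k+1) - cntH lam T r k =
      ((lam.cells.filter (fun p => p.1 < r ∧ T p.1 p.2 = k+1)).card : ℤ) := by
  unfold cntH
  have : lam.cells.filter (fun p => p.1 < r ∧ T p.1 p.2 ≤ k+1) =
      lam.cells.filter (fun p => p.1 < r ∧ T p.1 p.2 ≤ k) ∪
      lam.cells.filter (fun p => p.1 < r ∧ T p.1 p.2 = k+1) := by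
    ext p; simp only [Finset.mem_filter, Finset.mem_union]; grind
  rw [this, Finset.card_union_of_disjoint]
  · push_cast; ring
  · rw [Finset.disjoint_left]; intro p; simp only [Finset.mem_filter]; grind

theorem card_sub (lam : YoungDiagram) (P : ℕ × ℕ → Prop) [DecidablePred P] (hP : ∀ p, P p → p ∈ lam) :
    Nat.card {p : ℕ × ℕ // P p} = (lam.cells.filter P).card := by
  apply Nat.subtype_card
  intro p
  simp only [Finset.mem_filter, YoungDiagram.mem_cells]
  exact ⟨fun h => h.2, fun h => ⟨hP p h, h⟩⟩

theorem LRFilling.toHive {be ga lam : YoungDiagram} (F : LRFilling be ga lam) :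
    IsHive (rl be) (rl ga) (rl lam) (cntH lam F.T) := by
  have mem : ∀ p : ℕ × ℕ, F.T p.1 p.2 ≠ 0 → p ∈ lam := fun p hp => ((F.supp p.1 p.2).1 hp).1
  refine ⟨?_, ?_, ?_, ?_, ?_, ?_, ?_⟩
  · intro k; simp [cntH]
  · intro r
    rw [cntH_row, rl, be.rowLen_eq_card]
    congr 2
    ext p
    simp only [Finset.mem_filter, YoungDiagram.mem_cells, YoungDiagram.mem_row_iff]
    have h1 := F.supp p.1 p.2
    have h2 : p ∈ be → p ∈ lam := fun h => F.sub h
    grind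
  · refine ⟨lam.cells.sup (fun p => F.T p.1 p.2), fun k hk r => ?_⟩
    rw [cntH_row, rl, lam.rowLen_eq_card]
    congr 2
    ext p
    simp only [Finset.mem_filter, YoungDiagram.mem_cells, YoungDiagram.mem_row_iff]
    have : p ∈ lam → F.T p.1 p.2 ≤ k := fun h =>
      (Finset.le_sup (f := fun p : ℕ × ℕ => F.T p.1 p.2) ((YoungDiagram.mem_cells p).2 h)).trans hk
    tauto
  · refine ⟨lam.cells.sup Prod.fst + 1, fun r hr k => ?_⟩
    rw [cntH_col, rl, ← F.content, card_sub lam _ (fun p hp => mem p (by omega))]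
    congr 2
    ext p
    simp only [Finset.mem_filter]
    have : p ∈ lam.cells → p.1 ≤ lam.cells.sup Prod.fst := fun h => Finset.le_sup (f := Prod.fst) h
    grind
  · intro r k
    rw [cntH_row, cntH_row]
    norm_cast
    apply Finset.card_le_card
    intro p
    simp only [Finset.mem_filter]
    grind
  · intro r k
    rw [cntH_row lam F.T (r+1), cntH_row]
    norm_cast
    apply Finset.card_le_card_of_injOn (fun p => (r, p.2))
    · rintro ⟨i, j⟩
      simp only [Finset.coe_filter, Set.mem_ofPred_eq, YoungDiagram.mem_cells]
      rintro ⟨h1, rfl, h3⟩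
      refine ⟨lam.up_left_mem (by omega) le_rfl h1, trivial, ?_⟩
      by_cases hz : F.T r j = 0
      · omega
      · have hz2 : F.T (r+1) j ≠ 0 := by
          rw [← ne_eq, F.supp] at hz
          rw [F.supp]
          exact ⟨h1, fun hb => hz.2 (be.up_left_mem (by omega) le_rfl hb)⟩
        have := F.cols_strict r (r+1) j (by omega) hz hz2
        omega
    · rintro ⟨i, j⟩ h1 ⟨i', j'⟩ h2 h3
      simp only [Finset.coe_filter, Set.mem_ofPred_eq, Prod.mk.injEq] at *
      grind
  · intro r k
    rw [cntH_col lam F.T (r+1), cntH_col]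
    norm_cast
    obtain ⟨j, j1, j2⟩ : ∃ j, (∀ j', F.T r j' = k+2 → j ≤ j') ∧ (∀ j', F.T r j' = k+1 → j' < j) := by
      by_cases hx : ∃ j, k + 1 < F.T r j
      · classical
        refine ⟨Nat.find hx, fun j' hj' => Nat.find_min' hx (by omega), fun j' hj' => ?_⟩
        by_contra hcon
        push Not at hcon
        have h1 := Nat.find_spec hx
        have := F.rows_weak r _ _ hcon (by omega) (by omega)
        omega
      · push Not at hx
        refine ⟨lam.rowLen r, fun j' hj' => ?_, fun j' hj' => ?_⟩
        · have := hx j'; omega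
        · rw [← YoungDiagram.mem_iff_lt_rowLen]
          exact mem (r, j') (by simp only; omega)
    have hb := F.ballot r j k
    rw [card_sub lam _ (fun p hp => mem p (by omega)), card_sub lam _ (fun p hp => mem p (by omega))] at hb
    refine le_trans (Finset.card_le_card ?_) (hb.trans (Finset.card_le_card ?_))
    · rintro ⟨a, d⟩
      simp only [Finset.mem_filter]
      rintro ⟨h1, h2, h3⟩
      refine ⟨h1, ?_, h3⟩
      by_cases e : a = r
      · subst e; right; exact ⟨rfl, j1 d h3⟩
      · left; omega
    · rintro ⟨a, d⟩
      simp only [Finset.mem_filter]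
      rintro ⟨h1, h2, h3⟩
      refine ⟨h1, ?_, h3⟩
      rcases h2 with h2 | ⟨rfl, h2⟩
      · exact h2
      · have := j2 d h3; omega

open Classical in
/-- the filling attached to a hive -/
noncomputable def hiveT (h : ℕ → ℕ → ℤ) (r j : ℕ) : ℕ :=
  if hx : ∃ k, (j : ℤ) < h (r+1) k - h r k then Nat.find hx else 0

theorem IsHive.toLR {be ga lam : YoungDiagram} {h : ℕ → ℕ → ℤ}
    (H : IsHive (rl be) (rl ga) (rl lam) h) : Nonempty (LRFilling be ga lam) := by
  classical
  have ex : ∀ r j, j < lam.rowLen r → ∃ k, (j : ℤ) < h (r+1) k - h r k := by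
    intro r j hj
    obtain ⟨N, hN⟩ := H.hl
    refine ⟨N, ?_⟩
    rw [hN N le_rfl, rl]; exact_mod_cast hj
  have nex : ∀ r j, ¬ j < lam.rowLen r → hiveT h r j = 0 := by
    intro r j hj
    rw [hiveT, dif_neg]
    rintro ⟨k, hk⟩
    have := H.l_ge r k
    rw [rl] at this
    omega
  have tle : ∀ r j k, j < lam.rowLen r → (hiveT h r j ≤ k ↔ (j : ℤ) < h (r+1) k - h r k) := by
    intro r j k hj
    rw [hiveT, dif_pos (ex r j hj)]
    constructor
    · intro hk
      have h1 := Nat.find_spec (ex r j hj)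
      have h2 := H.mono r hk
      simp only at h2
      omega
    · intro hk; exact Nat.find_min' _ hk
  have t0 : ∀ r j, hiveT h r j ≠ 0 ↔ (j < lam.rowLen r ∧ ¬ j < be.rowLen r) := by
    intro r j
    by_cases hj : j < lam.rowLen r
    · have h1 := tle r j 0 hj
      have h2 := H.hb r
      rw [rl] at h2
      rw [h2] at h1
      norm_cast at h1
      simp only [hj, true_and, ← h1]
      omega
    · simp [nex r j hj, hj]
  have sub : ∀ r, be.rowLen r ≤ lam.rowLen r := by
    intro r
    have h1 := H.l_ge r 0
    rw [H.hb] at h1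
    simp only [rl] at h1
    omega
  have Lanti : ∀ d r k, h (r+d+1) k - h (r+d) k ≤ h (r+1) k - h r k := by
    intro d
    induction d with
    | zero => intro r k; exact le_rfl
    | succ d ih =>
      intro r k
      have h1 := ih r k
      have h2 := H.hcol (r+d) k
      have h3 := H.ha (r+d+1) k
      show h (r+d+2) k - h (r+d+1) k ≤ _
      have e : r + d + 1 + 1 = r + d + 2 := rfl
      rw [e] at h3
      omega
  have cnt : ∀ r k, cntH lam (hiveT h) r k = h r k := by
    intro r k
    induction r with
    | zero => rw [H.z]; simp [cntH]
    | succ r ih =>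
      have h1 := cntH_row lam (hiveT h) r k
      have h2 : lam.cells.filter (fun p => p.1 = r ∧ hiveT h p.1 p.2 ≤ k) =
          {r} ×ˢ Finset.range (h (r+1) k - h r k).toNat := by
        ext ⟨a, d⟩
        simp only [Finset.mem_filter, YoungDiagram.mem_cells, YoungDiagram.mem_iff_lt_rowLen,
          Finset.mem_product, Finset.mem_singleton, Finset.mem_range]
        constructor
        · rintro ⟨h4, rfl, h3⟩
          rw [tle _ _ _ h4] at h3
          exact ⟨rfl, by omega⟩
        · rintro ⟨rfl, h3⟩
          have h4 := H.l_ge a k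
          rw [rl] at h4
          have h5 : d < lam.rowLen a := by omega
          refine ⟨h5, rfl, ?_⟩
          rw [tle _ _ _ h5]; omega
      rw [h2] at h1
      simp only [Finset.card_product, Finset.card_singleton, Finset.card_range, one_mul] at h1
      have h3 := H.b_le r k
      rw [rl] at h3
      omega
  have memT : ∀ p : ℕ × ℕ, hiveT h p.1 p.2 ≠ 0 → p ∈ lam := by
    rintro ⟨a, d⟩ hp
    rw [YoungDiagram.mem_iff_lt_rowLen]
    exact ((t0 a d).1 hp).1
  refine ⟨⟨?_, hiveT h, ?_, ?_, ?_, ?_, ?_⟩⟩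
  · rintro ⟨a, d⟩ hp
    have hp' : (a, d) ∈ be := hp
    show (a, d) ∈ lam
    rw [YoungDiagram.mem_iff_lt_rowLen] at *
    exact hp'.trans_le (sub a)
  · intro i j
    rw [YoungDiagram.mem_iff_lt_rowLen, YoungDiagram.mem_iff_lt_rowLen]
    exact t0 i j
  · intro i j₁ j₂ hj h1 h2
    rw [t0] at h1 h2
    rw [tle _ _ _ h1.1]
    have := (tle i j₂ _ h2.1).1 le_rfl
    omega
  · intro i₁ i₂ j hi h1 h2
    have h3 := (t0 _ _).1 h1
    have h4 := (t0 _ _).1 h2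
    obtain ⟨k, hk⟩ : ∃ k, hiveT h i₂ j = k + 1 := ⟨hiveT h i₂ j - 1, by omega⟩
    have h5 := (tle i₂ j (k+1) h4.1).1 hk.le
    obtain ⟨d, rfl⟩ : ∃ d, i₂ = i₁ + d + 1 := ⟨i₂ - i₁ - 1, by omega⟩
    have h6 := H.hcol (i₁ + d) k
    have h7 := Lanti d i₁ k
    have e : i₁ + d + 1 + 1 = i₁ + d + 2 := rfl
    rw [e] at h5
    have h8 := (tle i₁ j k h3.1).2 (by omega)
    omega
  · intro k
    rw [card_sub lam _ (fun p hp => memT p (by omega))]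
    obtain ⟨N, hN⟩ := H.hc
    have h1 := hN (max N (lam.cells.sup Prod.fst + 1)) (le_max_left _ _) k
    rw [← cnt, ← cnt, cntH_col, rl] at h1
    norm_cast at h1
    rw [← h1]
    congr 1
    ext p
    simp only [Finset.mem_filter]
    have : p ∈ lam.cells → p.1 ≤ lam.cells.sup Prod.fst := fun h => Finset.le_sup (f := Prod.fst) h
    grind
  · intro i j k
    rw [card_sub lam _ (fun p hp => memT p (by omega)), card_sub lam _ (fun p hp => memT p (by omega))]
    have h1 := H.hbal i k
    have e : k + 1 + 1 = k + 2 := rfl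
    rw [← cnt, ← cnt, ← cnt, ← cnt, cntH_col, ← e, cntH_col] at h1
    norm_cast at h1
    refine le_trans (Finset.card_le_card ?_) (h1.trans (Finset.card_le_card ?_))
    · intro p; simp only [Finset.mem_filter]; grind
    · intro p; simp only [Finset.mem_filter]; grind

theorem card_eq_sum (μ : YoungDiagram) (N : ℕ) (hN : μ.card ≤ N) :
    (μ.card : ℤ) = ∑ r ∈ Finset.range N, rl μ r := by
  have h1 : ∀ p ∈ μ.cells, p.1 ∈ Finset.range N := by
    rintro ⟨a, d⟩ hp
    rw [YoungDiagram.mem_cells, YoungDiagram.mem_iff_lt_colLen, YoungDiagram.colLen_eq_card] at hp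
    have : (μ.col d).card ≤ μ.card := Finset.card_le_card (Finset.filter_subset _ _)
    simp only [Finset.mem_range]
    omega
  have h2 := Finset.card_eq_sum_card_fiberwise (f := Prod.fst) (s := μ.cells) (t := Finset.range N) h1
  have h3 : μ.card = ∑ r ∈ Finset.range N, μ.rowLen r := by
    refine h2.trans (Finset.sum_congr rfl (fun r _ => ?_))
    rw [YoungDiagram.rowLen_eq_card]; rfl
  rw [h3]; push_cast; rfl

theorem IsHive.card_eq {be ga lam : YoungDiagram} {h : ℕ → ℕ → ℤ}
    (H : IsHive (rl be) (rl ga) (rl lam) h) : lam.card = be.card + ga.card := by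
  obtain ⟨N1, hN1⟩ := H.hl
  obtain ⟨N2, hN2⟩ := H.hc
  obtain ⟨N, hN⟩ : ∃ N, N = N1 + N2 + lam.card + be.card + ga.card := ⟨_, rfl⟩
  have h1 := card_eq_sum lam N (by omega)
  have h2 := card_eq_sum be N (by omega)
  have h3 := card_eq_sum ga N (by omega)
  have e1 : ∑ r ∈ Finset.range N, rl lam r = h N N - h 0 N := by
    rw [← Finset.sum_range_sub (fun r => h r N)]
    exact Finset.sum_congr rfl (fun r _ => (hN1 N (by omega) r).symm)
  have e2 : ∑ r ∈ Finset.range N, rl be r = h N 0 - h 0 0 := by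
    rw [← Finset.sum_range_sub (fun r => h r 0)]
    exact Finset.sum_congr rfl (fun r _ => (H.hb r).symm)
  have e3 : ∑ r ∈ Finset.range N, rl ga r = h N N - h N 0 := by
    rw [← Finset.sum_range_sub (fun k => h N k)]
    exact Finset.sum_congr rfl (fun r _ => (hN2 N (by omega) r).symm)
  rw [H.z] at e1 e2
  omega

theorem cells_bound (ga : YoungDiagram) (n : ℕ) (hn : ga.card ≤ n) :
    ga.cells ⊆ Finset.range n ×ˢ Finset.range n := by
  rintro ⟨a, d⟩ hp
  rw [YoungDiagram.mem_cells] at hp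
  have h1 := hp
  rw [YoungDiagram.mem_iff_lt_colLen, YoungDiagram.colLen_eq_card] at h1
  rw [YoungDiagram.mem_iff_lt_rowLen, YoungDiagram.rowLen_eq_card] at hp
  have h2 : (ga.col d).card ≤ ga.card := Finset.card_le_card (Finset.filter_subset _ _)
  have h3 : (ga.row a).card ≤ ga.card := Finset.card_le_card (Finset.filter_subset _ _)
  simp only [Finset.mem_product, Finset.mem_range]
  omega

theorem LRFilling.finite (be ga lam : YoungDiagram) : Finite (LRFilling be ga lam) := by
  have bd : ∀ (F : LRFilling be ga lam) i j, F.T i j < ga.card + 1 := by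
    intro F i j
    by_contra hcon
    push Not at hcon
    obtain ⟨k, hk⟩ : ∃ k, F.T i j = k + 1 := ⟨F.T i j - 1, by omega⟩
    have h1 := F.content k
    rw [card_sub lam _ (fun p hp => ((F.supp p.1 p.2).1 (by omega)).1)] at h1
    have h2 : 0 < (lam.cells.filter (fun p => F.T p.1 p.2 = k + 1)).card := by
      rw [Finset.card_pos]
      refine ⟨(i, j), ?_⟩
      simp only [Finset.mem_filter, YoungDiagram.mem_cells]
      exact ⟨((F.supp i j).1 (by omega)).1, hk⟩
    rw [h1] at h2
    have h3 := cells_bound ga ga.card le_rfl ((YoungDiagram.mem_cells (k, 0)).2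
      (YoungDiagram.mem_iff_lt_rowLen.2 h2))
    simp only [Finset.mem_product, Finset.mem_range] at h3
    omega
  apply Finite.of_injective (β := lam.cells → Fin (ga.card + 1))
    (fun F p => ⟨F.T p.1.1 p.1.2, bd F _ _⟩)
  intro F G hFG
  have hT : F.T = G.T := by
    funext i j
    by_cases hp : (i, j) ∈ lam
    · have := congrFun hFG ⟨(i, j), (YoungDiagram.mem_cells _).2 hp⟩
      simpa using this
    · have h1 : F.T i j = 0 := by
        by_contra h; exact hp ((F.supp i j).1 h).1
      have h2 : G.T i j = 0 := by
        by_contra h; exact hp ((G.supp i j).1 h).1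
      rw [h1, h2]
  cases F; cases G; simp only at hT; subst hT; rfl

theorem NL_pos_iff (μ ν lam : YoungDiagram) : 0 < NL μ ν lam ↔
    ∃ α β γ : YoungDiagram, Nonempty (LRFilling α β μ) ∧ Nonempty (LRFilling α γ ν) ∧
      Nonempty (LRFilling β γ lam) := by
  rw [NL, Nat.card_pos_iff]
  constructor
  · rintro ⟨⟨α, β, γ, F1, F2, F3⟩, -⟩
    exact ⟨α, β, γ, ⟨F1⟩, ⟨F2⟩, ⟨F3⟩⟩
  · rintro ⟨α, β, γ, ⟨F1⟩, ⟨F2⟩, ⟨F3⟩⟩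
    refine ⟨⟨α, β, γ, F1, F2, F3⟩, ?_⟩
    let n := μ.card + ν.card
    let A := {δ : YoungDiagram // δ.cells ⊆ Finset.range n ×ˢ Finset.range n}
    have hA : Finite A := by
      apply Finite.of_injective (β := (Finset.range n ×ˢ Finset.range n).powerset)
        (fun δ => ⟨δ.1.cells, Finset.mem_powerset.2 δ.2⟩)
      intro x y hxy
      apply Subtype.ext
      apply YoungDiagram.ext
      simpa using hxy
    have fin1 := LRFilling.finite
    apply Finite.of_surjective
      (α := Σ x : A × A × A, (LRFilling x.1.1 x.2.1.1 μ × LRFilling x.1.1 x.2.2.1 ν × LRFilling x.2.1.1 x.2.2.1 lam))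
      (fun x => ⟨x.1.1.1, x.1.2.1.1, x.1.2.2.1, x.2⟩)
    rintro ⟨α, β, γ, F1, F2, F3⟩
    have c1 := F1.toHive.card_eq
    have c2 := F2.toHive.card_eq
    exact ⟨⟨(⟨α, cells_bound α n (by omega)⟩, ⟨β, cells_bound β n (by omega)⟩,
      ⟨γ, cells_bound γ n (by omega)⟩), F1, F2, F3⟩, rfl⟩

theorem rowLen_mono {μ ν : YoungDiagram} (h : μ ≤ ν) (r : ℕ) : μ.rowLen r ≤ ν.rowLen r := by
  by_contra hcon
  push Not at hcon
  have h1 : (r, ν.rowLen r) ∈ μ := YoungDiagram.mem_iff_lt_rowLen.2 hcon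
  have h2 : (r, ν.rowLen r) ∈ ν := h h1
  rw [YoungDiagram.mem_iff_lt_rowLen] at h2
  omega

theorem le_of_rowLen {μ ν : YoungDiagram} (h : ∀ r, μ.rowLen r ≤ ν.rowLen r) : μ ≤ ν := by
  rintro ⟨a, d⟩ hp
  have hp' : (a, d) ∈ μ := hp
  show (a, d) ∈ ν
  rw [YoungDiagram.mem_iff_lt_rowLen] at *
  exact hp'.trans_le (h a)

theorem exists_sub (μ : YoungDiagram) (g : ℕ → ℤ) (h0 : ∀ r, 0 ≤ g r) (h1 : ∀ r, g (r+1) ≤ g r)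
    (h2 : ∀ r, g r ≤ rl μ r) : ∃ δ : YoungDiagram, δ ≤ μ ∧ rl δ = g := by
  have an : Antitone g := antitone_nat_of_succ_le h1
  let δ : YoungDiagram := ⟨μ.cells.filter (fun p => (p.2 : ℤ) < g p.1), by
    rintro ⟨a, d⟩ ⟨a', d'⟩ hle hp
    obtain ⟨l1, l2⟩ := Prod.mk_le_mk.1 hle
    simp only [Finset.coe_filter, Set.mem_ofPred_eq, YoungDiagram.mem_cells] at hp ⊢
    have := an l1
    exact ⟨μ.up_left_mem l1 l2 hp.1, by omega⟩⟩
  have hm : ∀ a d, (a, d) ∈ δ ↔ (d : ℤ) < g a := by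
    intro a d
    rw [← YoungDiagram.mem_cells]
    simp only [δ, Finset.mem_filter, YoungDiagram.mem_cells, YoungDiagram.mem_iff_lt_rowLen]
    have := h2 a
    rw [rl] at this
    omega
  have hr : rl δ = g := by
    funext r
    have k1 := hm r (g r).toNat
    have k2 := hm r (δ.rowLen r)
    have := h0 r
    rw [YoungDiagram.mem_iff_lt_rowLen] at k1 k2
    rw [rl]
    omega
  refine ⟨δ, le_of_rowLen (fun r => ?_), hr⟩
  have := h2 r
  rw [← hr] at this
  simp only [rl] at this
  omega

theorem rl_eventually (μ : YoungDiagram) : ∃ M, ∀ k, M ≤ k → rl μ k = 0 := by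
  refine ⟨μ.card, fun k hk => ?_⟩
  rw [rl]
  by_contra hcon
  have : (k, 0) ∈ μ := YoungDiagram.mem_iff_lt_rowLen.2 (by omega)
  have h3 := cells_bound μ μ.card le_rfl ((YoungDiagram.mem_cells (k, 0)).2 this)
  simp only [Finset.mem_product, Finset.mem_range] at h3
  omega

/-- If `N_{μ,ν,lam} > 0` and `|lam| > |μ Δ ν|` (where
`|μ Δ ν| = |μ| + |ν| - 2|μ ⊓ ν|`), then there is `lam'' ⊂ lam` with
`|lam''| = |lam| - 2` and `N_{μ,ν,lam''} > 0`. -/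
theorem NL_down (μ ν lam : YoungDiagram) (h : 0 < NL μ ν lam)
    (hgt : μ.card + ν.card - 2 * (μ ⊓ ν).card < lam.card) :
    ∃ lam'' : YoungDiagram, lam'' ≤ lam ∧ lam''.card + 2 = lam.card ∧
      0 < NL μ ν lam'' := by
  obtain ⟨α, β, γ, ⟨F1⟩, ⟨F2⟩, ⟨F3⟩⟩ := (NL_pos_iff _ _ _).1 h
  have c1 := F1.toHive.card_eq
  have c2 := F2.toHive.card_eq
  have c3 := F3.toHive.card_eq
  have hi : ∃ i, α.rowLen i < (μ ⊓ ν).rowLen i := by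
    by_contra hcon
    push Not at hcon
    have h1 : (μ ⊓ ν).card ≤ α.card :=
      Finset.card_le_card (YoungDiagram.cells_subset_iff.2 (le_of_rowLen hcon))
    omega
  classical
  obtain ⟨i, hi1, hi2⟩ : ∃ i, α.rowLen i < (μ ⊓ ν).rowLen i ∧
      ∀ r, r + 1 = i → α.rowLen i < α.rowLen r := by
    refine ⟨Nat.find hi, Nat.find_spec hi, fun r hr => ?_⟩
    have h1 := Nat.find_spec hi
    have h2 := Nat.find_min hi (show r < Nat.find hi by omega)
    have h3 := (μ ⊓ ν).rowLen_anti r (Nat.find hi) (by omega)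
    omega
  have hiμ := hi1.trans_le (rowLen_mono (inf_le_left : μ ⊓ ν ≤ μ) i)
  have hiν := hi1.trans_le (rowLen_mono (inf_le_right : μ ⊓ ν ≤ ν) i)
  have hi3 : ∀ r, r + 1 = i → rl α i < rl α r := fun r hr => by
    have := hi2 r hr; simp only [rl]; omega
  obtain ⟨α', hα'1, hα'2⟩ := exists_sub μ (fun r => rl α r + if r = i then 1 else 0)
    (fun r => by simp only [rl]; split_ifs <;> omega)
    (fun r => by
      have h1 := hi2 r
      have h2 := α.rowLen_anti r (r+1) (by omega)
      simp only [rl]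
      by_cases e : r + 1 = i
      · subst e; have := h1 rfl; split_ifs <;> omega
      · split_ifs <;> omega)
    (fun r => by
      have h1 := rowLen_mono F1.sub r
      simp only [rl]
      by_cases e : r = i
      · subst e; split_ifs <;> omega
      · split_ifs <;> omega)
  have cα : α'.card = α.card + 1 := by
    have h1 := card_eq_sum α' (α.card + α'.card + i + 1) (by omega)
    have h2 := card_eq_sum α (α.card + α'.card + i + 1) (by omega)
    rw [hα'2, Finset.sum_add_distrib, ← h2, Finset.sum_ite_eq',
      if_pos (Finset.mem_range.2 (by omega))] at h1
    omega
  obtain ⟨j, h1, H1⟩ := F1.toHive.addInner i hi3 (by simp only [rl]; omega) (rl_eventually β)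
  obtain ⟨y, h2, H2⟩ := F2.toHive.addInner i hi3 (by simp only [rl]; omega) (rl_eventually γ)
  obtain ⟨β', hβ1, hβ2⟩ := exists_sub β _
    (fun k => (H1.C_nonneg 0 k).trans (H1.c_ge 0 k)) H1.c_anti
    (fun r => by split_ifs <;> omega)
  obtain ⟨γ', hγ1, hγ2⟩ := exists_sub γ _
    (fun k => (H2.C_nonneg 0 k).trans (H2.c_ge 0 k)) H2.c_anti
    (fun r => by split_ifs <;> omega)
  obtain ⟨j1, h3, H3⟩ := F3.toHive.slide j (by
    have := H1.c_anti j
    simp only [Nat.succ_ne_self, if_true, if_false] at this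
    omega)
  obtain ⟨j2, h4, H4⟩ := H3.remContent y (by
    have := H2.c_anti y
    simp only [Nat.succ_ne_self, if_true, if_false] at this
    omega)
  rw [← hα'2, ← hβ2] at H1
  rw [← hα'2, ← hγ2] at H2
  rw [← hβ2, ← hγ2] at H4
  obtain ⟨lam', hl1, hl2⟩ := exists_sub lam _
    (fun r => by
      have h5 := (H4.b_le r 0).trans (H4.l_ge r 0)
      have h6 : 0 ≤ rl β' r := by simp [rl]
      exact h6.trans h5) H4.l_anti
    (fun r => by split_ifs <;> omega)
  rw [← hl2] at H4
  have d1 := H1.card_eq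
  have d2 := H2.card_eq
  have d4 := H4.card_eq
  exact ⟨lam', hl1, by omega, (NL_pos_iff _ _ _).2 ⟨α', β', γ', H1.toLR, H2.toLR, H4.toLR⟩⟩
end

section
/- If c^λ_{β,γ} > 0 and γ⁺ ⊃ γ with |γ⁺/γ| = 1, then there exists a partition λ⁺ ⊃ λ with |λ⁺/λ| = 1 such that c^{λ⁺}_{β,γ⁺} > 0. -/
open YoungDiagram

/-- Number of entries `k+1` in rows `< i`, computed from the chain of shapes `L`. -/
def lrN (L : ℕ → ℕ → ℕ) (k i : ℕ) : ℕ := ∑ x ∈ Finset.range i, (L (k+1) x - L k x)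

lemma lrN_zero (L : ℕ → ℕ → ℕ) (k : ℕ) : lrN L k 0 = 0 := by simp [lrN]

lemma lrN_succ (L : ℕ → ℕ → ℕ) (k i : ℕ) :
    lrN L k (i+1) = lrN L k i + (L (k+1) i - L k i) := by
  simp [lrN, Finset.sum_range_succ]

lemma lr_card_initial (L T : ℕ → ℕ → ℕ)
    (R : ∀ i j k, T i j = k + 1 ↔ L k i ≤ j ∧ j < L (k+1) i) (i j k : ℕ) :
    Nat.card {p : ℕ × ℕ // (p.1 < i ∨ (p.1 = i ∧ j ≤ p.2)) ∧ T p.1 p.2 = k + 1} =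
      lrN L k i + (L (k+1) i - max j (L k i)) := by
  classical
  have h1 : ∀ p : ℕ × ℕ, p ∈ ((Finset.range (i+1)).sigma
      (fun x => Finset.Ico (if x = i then max j (L k x) else L k x) (L (k+1) x))).map
        (Equiv.sigmaEquivProd ℕ ℕ).toEmbedding ↔
      ((p.1 < i ∨ (p.1 = i ∧ j ≤ p.2)) ∧ T p.1 p.2 = k + 1) := by
    rintro ⟨x, y⟩
    rw [Finset.mem_map_equiv]
    simp only [Equiv.sigmaEquivProd_symm_apply, Finset.mem_sigma, Finset.mem_range,
      Finset.mem_Ico, R]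
    split_ifs with hx
    · subst hx
      simp
      omega
    · omega
  have h2 := Nat.subtype_card _ h1
  rw [h2, Finset.card_map, Finset.card_sigma, Finset.sum_range_succ, lrN]
  simp only [Nat.card_Ico, if_true]
  congr 1
  apply Finset.sum_congr rfl
  intro x hx
  have : x ≠ i := by
    have := Finset.mem_range.1 hx
    omega
  simp [this]

/-- The chain of shapes `L k = β ∪ {entries ≤ k}` of an LR filling. -/
structure LRChain (b c l : YoungDiagram) (L : ℕ → ℕ → ℕ) : Prop where
  zero : ∀ i, L 0 i = b.rowLen i
  top : ∀ i j, j < l.rowLen i ↔ ∃ k, j < L k i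
  A : ∀ k i, L k i ≤ L (k+1) i
  B : ∀ k i, L (k+1) (i+1) ≤ L k i
  C : ∀ k i, lrN L (k+1) (i+1) ≤ lrN L k i
  content : ∃ n, ∀ i, n ≤ i → ∀ k, lrN L k i = c.rowLen k

lemma rowLen_large (l : YoungDiagram) (i : ℕ) (hi : l.colLen 0 ≤ i) : l.rowLen i = 0 := by
  by_contra h
  have : (i, 0) ∈ l := mem_iff_lt_rowLen.2 (Nat.pos_of_ne_zero h)
  have := mem_iff_lt_colLen.1 this
  omega

lemma lr_card_total (L T : ℕ → ℕ → ℕ)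
    (R : ∀ i j k, T i j = k + 1 ↔ L k i ≤ j ∧ j < L (k+1) i) (n k : ℕ)
    (hn : ∀ i, n ≤ i → L (k+1) i = 0) :
    Nat.card {p : ℕ × ℕ // T p.1 p.2 = k + 1} = lrN L k n := by
  have h := lr_card_initial L T R n 0 k
  rw [hn n le_rfl] at h
  simp only [zero_le, and_true, Nat.zero_sub, add_zero] at h
  rw [← h]
  apply Nat.card_congr
  apply Equiv.subtypeEquivRight
  rintro ⟨x, y⟩
  simp only
  constructor
  · intro hT
    refine ⟨?_, hT⟩
    by_contra hx
    have h1 := ((R _ _ _).1 hT).2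
    rw [hn x (by omega)] at h1
    omega
  · exact fun h => h.2

lemma LRFilling.exists_chain {b c l : YoungDiagram} (F : LRFilling b c l) :
    ∃ L, LRChain b c l L := by
  classical
  obtain ⟨sub, T, supp, rows, cols, content, ballot⟩ := F
  have hz : ∀ i j, T i j = 0 ↔ (l.rowLen i ≤ j ∨ j < b.rowLen i) := by
    intro i j
    have := supp i j
    rw [mem_iff_lt_rowLen, mem_iff_lt_rowLen] at this
    omega
  have hbl : ∀ i, b.rowLen i ≤ l.rowLen i := by
    intro i
    by_contra hlt
    have : (i, l.rowLen i) ∈ b := mem_iff_lt_rowLen.2 (by omega)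
    have := mem_iff_lt_rowLen.1 (sub this)
    omega
  have hL : ∀ k i, ∃ m, ∀ j, j < m ↔ (j < l.rowLen i ∧ T i j ≤ k) := by
    intro k i
    have hex : ∃ j, ¬ (j < l.rowLen i ∧ T i j ≤ k) := ⟨l.rowLen i, by simp⟩
    refine ⟨Nat.find hex, fun j => ?_⟩
    rw [Nat.lt_find_iff]
    push Not
    constructor
    · exact fun h => h j le_rfl
    · intro h m hm
      refine ⟨by omega, ?_⟩
      by_cases h0 : T i m = 0
      · omega
      · have h1 : T i j ≠ 0 := by
          have := hz i j
          have := hz i m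
          omega
        have := rows i m j hm h0 h1
        omega
  choose L hL using hL
  have A : ∀ k i, L k i ≤ L (k+1) i := by
    intro k i
    by_contra hlt
    have h1 := hL k i (L (k+1) i)
    have h2 := hL (k+1) i (L (k+1) i)
    omega
  have R : ∀ i j k, T i j = k + 1 ↔ L k i ≤ j ∧ j < L (k+1) i := by
    intro i j k
    have h1 := hL k i j
    have h2 := hL (k+1) i j
    have h3 := hz i j
    omega
  have hle : ∀ k i, L k i ≤ l.rowLen i := by
    intro k i
    have := hL k i (l.rowLen i)
    omega
  refine ⟨L, ?_, ?_, A, ?_, ?_, ?_⟩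
  · intro i
    have h1 := hL 0 i (L 0 i)
    have h2 := hL 0 i (b.rowLen i)
    have h3 := hz i (L 0 i)
    have h4 := hz i (b.rowLen i)
    have h5 := hbl i
    have h6 := hle 0 i
    omega
  · intro i j
    constructor
    · intro h
      exact ⟨T i j, (hL _ _ _).2 ⟨h, le_rfl⟩⟩
    · rintro ⟨k, hk⟩
      exact ((hL _ _ _).1 hk).1
  · intro k i
    by_contra hlt
    have h1 := (hL (k+1) (i+1) (L k i)).1 (by omega)
    have h2 := hL k i (L k i)
    have h3 := l.rowLen_anti i (i+1) (by omega)
    have h4 := b.rowLen_anti i (i+1) (by omega)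
    have h5 := hz i (L k i)
    have h6 := hz (i+1) (L k i)
    have h7 := cols i (i+1) (L k i) (by omega)
    omega
  · intro k i
    have h := ballot i (L (k+1) i) k
    rw [lr_card_initial L T R, show k + 2 = (k+1) + 1 from rfl, lr_card_initial L T R] at h
    rw [lrN_succ]
    have := A k i
    have e1 : max (L (k+1) i) (L k i) = L (k+1) i := by omega
    rw [e1, max_self] at h
    omega
  · refine ⟨l.colLen 0, fun i hi k => ?_⟩
    rw [← content k, lr_card_total L T R i k]
    intro x hx
    have := hle (k+1) x
    have := rowLen_large l x (by omega)
    omega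

lemma LRChain.mono {b c l : YoungDiagram} {L : ℕ → ℕ → ℕ} (H : LRChain b c l L) (i : ℕ) :
    Monotone (fun k => L k i) := monotone_nat_of_le_succ (fun k => H.A k i)

lemma LRChain.le_top {b c l : YoungDiagram} {L : ℕ → ℕ → ℕ} (H : LRChain b c l L) (k i : ℕ) :
    L k i ≤ l.rowLen i := by
  by_contra h
  have := (H.top i (l.rowLen i)).2 ⟨k, by omega⟩
  omega

lemma LRChain.nonempty {b c l : YoungDiagram} {L : ℕ → ℕ → ℕ} (H : LRChain b c l L) :
    Nonempty (LRFilling b c l) := by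
  classical
  have hT : ∀ i j, ∃ t, (∀ k, t = k + 1 ↔ L k i ≤ j ∧ j < L (k+1) i) := by
    intro i j
    by_cases h : ∃ k, j < L k i
    · refine ⟨Nat.find h, fun k => ?_⟩
      rw [Nat.find_eq_iff]
      constructor
      · rintro ⟨h1, h2⟩
        exact ⟨by simpa using h2 k (by omega), h1⟩
      · rintro ⟨h1, h2⟩
        refine ⟨h2, fun n hn => ?_⟩
        have := H.mono i (show n ≤ k by omega)
        simp only at this
        omega
    · refine ⟨0, fun k => ?_⟩
      push Not at h
      have := h (k+1)
      omega
  choose T R using hT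
  have hz : ∀ i j, T i j ≠ 0 ↔ j < l.rowLen i ∧ b.rowLen i ≤ j := by
    intro i j
    rw [← H.zero]
    constructor
    · intro h
      obtain ⟨k, hk⟩ := Nat.exists_eq_succ_of_ne_zero h
      obtain ⟨h1, h2⟩ := (R i j k).1 hk
      have h3 := H.mono i (Nat.zero_le k)
      simp only at h3
      exact ⟨(H.top _ _).2 ⟨_, h2⟩, by omega⟩
    · rintro ⟨h1, h2⟩
      have h := (H.top _ _).1 h1
      have h3 := Nat.find_spec h
      have h4 : Nat.find h ≠ 0 := by
        intro h0
        rw [h0] at h3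
        omega
      obtain ⟨k, hk⟩ := Nat.exists_eq_succ_of_ne_zero h4
      have h5 := Nat.find_min h (m := k) (by omega)
      rw [hk] at h3
      have := (R i j k).2 ⟨by omega, h3⟩
      omega
  have hlt : ∀ i j k, T i j ≠ 0 → (T i j ≤ k ↔ j < L k i) := by
    intro i j k h
    obtain ⟨t, ht⟩ := Nat.exists_eq_succ_of_ne_zero h
    obtain ⟨h1, h2⟩ := (R i j t).1 ht
    constructor
    · intro hk
      have := H.mono i (show t+1 ≤ k by omega)
      simp only at this
      omega
    · intro hk
      by_contra hc
      have := H.mono i (show k ≤ t by omega)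
      simp only at this
      omega
  refine ⟨⟨?_, T, ?_, ?_, ?_, ?_, ?_⟩⟩
  · rintro ⟨i, j⟩ h
    have h : (i, j) ∈ b := h
    change (i, j) ∈ l
    rw [mem_iff_lt_rowLen] at h ⊢
    rw [← H.zero] at h
    exact (H.top _ _).2 ⟨_, h⟩
  · intro i j
    rw [hz, mem_iff_lt_rowLen, mem_iff_lt_rowLen]
    omega
  · intro i j₁ j₂ hj h1 h2
    have := hlt i j₁ (T i j₂) h1
    have := hlt i j₂ (T i j₂) h2
    omega
  · intro i₁ i₂ j hi h1 h2
    have key : ∀ d k, L (k+1) (i₁ + d + 1) ≤ L k i₁ := by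
      intro d
      induction d with
      | zero => intro k; exact H.B k i₁
      | succ d ih =>
        intro k
        have e1 := ih k
        have e2 : L (k+2) (i₁ + (d+1) + 1) ≤ L (k+1) (i₁ + d + 1) := H.B (k+1) (i₁ + d + 1)
        have e3 : L (k+1) (i₁ + (d+1) + 1) ≤ L (k+2) (i₁ + (d+1) + 1) := H.A (k+1) _
        omega
    obtain ⟨t, ht⟩ := Nat.exists_eq_succ_of_ne_zero h2
    have e1 := key (i₂ - i₁ - 1) t
    rw [show i₁ + (i₂ - i₁ - 1) + 1 = i₂ by omega] at e1
    have e2 := (R i₂ j t).1 ht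
    have e3 := hlt i₁ j t h1
    omega
  · intro k
    obtain ⟨n, hn⟩ := H.content
    rw [← hn (max n (l.colLen 0)) (by omega) k]
    apply lr_card_total L T (fun i j k => R i j k)
    intro i hi
    have := H.le_top (k+1) i
    have := rowLen_large l i (by omega)
    omega
  · intro i j k
    rw [lr_card_initial L T (fun i j k => R i j k), show k + 2 = (k+1) + 1 from rfl,
      lr_card_initial L T (fun i j k => R i j k)]
    have h1 := H.C k i
    rw [lrN_succ] at h1
    omega

instance lr_finite (b c l : YoungDiagram) : Finite (LRFilling b c l) := by
  classical
  have hb : ∀ (F : LRFilling b c l) i j, F.T i j < c.colLen 0 + 1 := by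
    intro F i j
    by_contra hlt
    obtain ⟨k, hk⟩ := Nat.exists_eq_succ_of_ne_zero (show F.T i j ≠ 0 by omega)
    have h1 := F.content k
    rw [rowLen_large c k (by omega)] at h1
    have hfin : Finite {p : ℕ × ℕ // F.T p.1 p.2 = k + 1} := by
      apply Set.Finite.subset l.cells.finite_toSet
      rintro ⟨x, y⟩ (h : F.T x y = k + 1)
      have := ((F.supp x y).1 (by omega)).1
      simpa using this
    have : Nonempty {p : ℕ × ℕ // F.T p.1 p.2 = k + 1} := ⟨⟨(i, j), hk⟩⟩
    have := Nat.card_pos (α := {p : ℕ × ℕ // F.T p.1 p.2 = k + 1})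
    omega
  let φ : LRFilling b c l → (l.cells → Fin (c.colLen 0 + 1)) :=
    fun F p => ⟨F.T p.1.1 p.1.2, hb F _ _⟩
  apply Finite.of_injective φ
  intro F G h
  have hT : F.T = G.T := by
    funext i j
    by_cases hm : (i, j) ∈ l
    · have := congrFun h ⟨(i, j), by simpa using hm⟩
      simpa [φ] using this
    · have h1 := F.supp i j
      have h2 := G.supp i j
      have h1' : F.T i j = 0 := by
        by_contra hc
        exact hm (h1.1 hc).1
      have h2' : G.T i j = 0 := by
        by_contra hc
        exact hm (h2.1 hc).1
      rw [h1', h2']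
  cases F
  cases G
  cases hT
  rfl

/-- Conditions for adding the indicator of the region `S`, in rows up to `n`. -/
structure LRRegion (L : ℕ → ℕ → ℕ) (S : ℕ → ℕ → Prop) (n : ℕ) : Prop where
  s0 : ∀ m, ¬ S 0 m
  sz : ∀ i, i ≤ n → ¬ S i 0
  up : ∀ i m, i ≤ n → S i m → S i (m+1)
  right : ∀ i m, i < n → S i m → S (i+1) m
  slack : ∀ i k, i < n → S (i+1) (k+2) → ¬ S (i+1) (k+1) → lrN L (k+1) (i+1) < lrN L k i
  A : ∀ i m, i < n → S i (m+1) → ¬ S i m → S (i+1) m → L m i < L (m+1) i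
  B : ∀ i m, i + 1 < n → S (i+2) (m+1) → ¬ S (i+1) (m+1) → L (m+1) (i+1) < L m i

lemma LRRegion.extend {L : ℕ → ℕ → ℕ} {S : ℕ → ℕ → Prop} {n : ℕ} (G : LRRegion L S (n+1))
    (k : ℕ) (hk : lrN L (k+1) (n+2) < lrN L k (n+1))
    (hS : ∀ m, S (n+1) m → k + 2 ≤ m)
    (hA : ∀ m, S (n+1) (m+1) → ¬ S (n+1) m → k + 2 ≤ m → L m (n+1) < L (m+1) (n+1))
    (hB : ∀ m, k + 2 ≤ m + 1 → ¬ S (n+1) (m+1) → L (m+1) (n+1) < L m n) :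
    LRRegion L (fun i m => if i = n + 2 then k + 2 ≤ m else S i m) (n+2) := by
  constructor
  · intro m
    simpa using G.s0 m
  · intro i hi
    split_ifs with h
    · omega
    · exact G.sz i (by omega)
  · intro i m hi
    split_ifs with h
    · omega
    · exact G.up i m (by omega)
  · intro i m hi
    rw [if_neg (by omega)]
    split_ifs with h
    · obtain rfl : i = n + 1 := by omega
      exact hS m
    · exact G.right i m (by omega)
  · intro i m hi
    split_ifs with h
    · obtain rfl : i = n + 1 := by omega
      intro h1 h2
      obtain rfl : m = k := by omega
      exact hk
    · exact G.slack i m (by omega)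
  · intro i m hi
    rw [if_neg (by omega), if_neg (by omega)]
    split_ifs with h
    · obtain rfl : i = n + 1 := by omega
      exact hA m
    · exact G.A i m (by omega)
  · intro i m hi
    rw [if_neg (show i + 1 ≠ n + 2 by omega)]
    split_ifs with h
    · obtain rfl : i = n := by omega
      exact hB m
    · exact G.B i m (by omega)

lemma LRChain.region {b c l : YoungDiagram} {L : ℕ → ℕ → ℕ} (H : LRChain b c l L) (n : ℕ) :
    ∀ k, lrN L (k+1) (n+1) < lrN L k n →
      ∃ S, LRRegion L S (n+1) ∧ ∀ m, S (n+1) m ↔ k + 2 ≤ m := by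
  classical
  induction n with
  | zero =>
    intro k hk
    rw [lrN_zero] at hk
    omega
  | succ n ih =>
    intro k hk
    -- strict inequality propagates along row `n+1`
    have prop0 : ¬ lrN L (k+1) (n+1) < lrN L k n → L (k+2) (n+1) < L (k+1) n := by
      intro h
      have h1 := hk
      rw [lrN_succ, lrN_succ L k] at h1
      have := H.C k n
      have := H.B k n
      have := H.A k n
      have : L (k+1) (n+1) ≤ L (k+2) (n+1) := H.A (k+1) (n+1)
      rw [show k + 1 + 1 = k + 2 from rfl] at h1
      omega
    have prop1 : ∀ s, L (s+1) (n+1) < L s n →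
        ¬ (lrN L (s+1) (n+1) < lrN L s n ∧ L (s+1) (n+1) < L (s+2) (n+1)) →
        L (s+2) (n+1) < L (s+1) n := by
      intro s hs h
      have h1 := H.C s (n+1)
      rw [lrN_succ, lrN_succ L s] at h1
      have := H.C s n
      have := H.A s n
      have : L (s+1) (n+1) ≤ L (s+2) (n+1) := H.A (s+1) (n+1)
      rw [show s + 1 + 1 = s + 2 from rfl] at h1
      omega
    let E : ℕ → Prop := fun s => k ≤ s ∧ lrN L (s+1) (n+1) < lrN L s n ∧
      (s = k ∨ L (s+1) (n+1) < L (s+2) (n+1))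
    have strict : ∀ d, (∀ s, s ≤ k + d → ¬ E s) → L (k + d + 2) (n+1) < L (k + d + 1) n := by
      intro d
      induction d with
      | zero =>
        intro h
        apply prop0
        intro h'
        exact h k le_rfl ⟨le_rfl, h', Or.inl rfl⟩
      | succ d ihd =>
        intro h
        have h1 := ihd (fun s hs => h s (by omega))
        apply prop1 (k + (d+1)) h1
        intro h'
        exact h (k + (d+1)) le_rfl ⟨by omega, h'.1, Or.inr h'.2⟩
    by_cases hE : ∃ s, E s
    · obtain ⟨h1, h2, h3⟩ := Nat.find_spec hE
      have hmin := fun m => Nat.find_min hE (m := m)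
      generalize Nat.find hE = s at *
      obtain ⟨S, G, hS⟩ := ih s h2
      refine ⟨_, G.extend k hk ?_ ?_ ?_, fun m => by simp⟩
      · intro m hm
        have := (hS m).1 hm
        omega
      · intro m hm1 hm2 hm
        rw [hS] at hm1 hm2
        obtain rfl : m = s + 1 := by omega
        rcases h3 with h3 | h3
        · omega
        · exact h3
      · intro m hm1 hm2
        rw [hS] at hm2
        have := strict (m - k - 1) (fun x hx => hmin x (by omega))
        rw [show k + (m - k - 1) + 2 = m + 1 by omega,
          show k + (m - k - 1) + 1 = m by omega] at this
        exact this
    · push Not at hE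
      have G : LRRegion L (fun _ _ => False) (n+1) := by
        constructor <;> simp
      refine ⟨_, G.extend k hk (by simp) (by simp) ?_, fun m => by simp⟩
      intro m hm1 _
      have := strict (m - k - 1) (fun x hx => hE x)
      rw [show k + (m - k - 1) + 2 = m + 1 by omega,
        show k + (m - k - 1) + 1 = m by omega] at this
      exact this

/-- A region for all rows, meeting the content side at letter `r+1`. -/
lemma LRChain.full_region {b c l cp : YoungDiagram} {L : ℕ → ℕ → ℕ} (H : LRChain b c l L)
    (r : ℕ) (hr : ∀ k, cp.rowLen k = c.rowLen k + if k = r then 1 else 0) :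
    ∃ S n, (∀ N, LRRegion L S N) ∧ ∀ i, n ≤ i → ∀ m, S i m ↔ r + 1 ≤ m := by
  obtain ⟨n, hn⟩ := H.content
  rcases r with _ | k
  · refine ⟨fun i m => 1 ≤ i ∧ 1 ≤ m, 1, fun N => ?_, fun i hi m => by simp; omega⟩
    constructor
    · intro m; omega
    · intro i; omega
    · intro i m; omega
    · intro i m; omega
    · intro i m; omega
    · intro i m; omega
    · intro i m; omega
  · have hck : c.rowLen (k+1) < c.rowLen k := by
      have h1 := hr (k+1)
      have h2 := hr k
      have h3 := cp.rowLen_anti k (k+1) (by omega)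
      rw [if_pos rfl] at h1
      rw [if_neg (by omega)] at h2
      omega
    have hsl : ∀ i, n ≤ i → lrN L (k+1) (i+1) < lrN L k i := by
      intro i hi
      rw [hn i hi, hn (i+1) (by omega)]
      exact hck
    obtain ⟨S, G, hS⟩ := H.region n k (hsl n le_rfl)
    refine ⟨fun i m => if i ≤ n then S i m else k + 2 ≤ m, n + 1, fun N => ?_, fun i hi m => by
      simp only
      rw [if_neg (by omega)]⟩
    have e : ∀ i m, n + 1 ≤ i → ((if i ≤ n then S i m else k + 2 ≤ m) ↔ k + 2 ≤ m) := by
      intro i m hi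
      rw [if_neg (by omega)]
    have e' : ∀ i m, i ≤ n + 1 → ((if i ≤ n then S i m else k + 2 ≤ m) ↔ S i m) := by
      intro i m hi
      split_ifs with h
      · rfl
      · obtain rfl : i = n + 1 := by omega
        exact (hS m).symm
    constructor
    · intro m
      rw [e' 0 m (by omega)]
      exact G.s0 m
    · intro i _
      rcases le_total i (n+1) with h | h
      · rw [e' i _ h]; exact G.sz i h
      · rw [e i _ h]; omega
    · intro i m _
      rcases le_total i (n+1) with h | h
      · rw [e' i _ h, e' i _ h]; exact G.up i m h
      · rw [e i _ h, e i _ h]; omega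
    · intro i m _
      rcases Nat.lt_or_ge i (n+1) with h | h
      · rw [e' i _ (by omega), e' (i+1) _ (by omega)]; exact G.right i m h
      · rw [e i _ h, e (i+1) _ (by omega)]; exact id
    · intro i m _
      rcases Nat.lt_or_ge i (n+1) with h | h
      · rw [e' (i+1) _ (by omega), e' (i+1) _ (by omega)]; exact G.slack i m h
      · rw [e (i+1) _ (by omega), e (i+1) _ (by omega)]
        intro h1 h2
        obtain rfl : m = k := by omega
        exact hsl i (by omega)
    · intro i m _
      rcases Nat.lt_or_ge i (n+1) with h | h
      · rw [e' i _ (by omega), e' i _ (by omega), e' (i+1) _ (by omega)]; exact G.A i m h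
      · rw [e i _ h, e i _ h, e (i+1) _ (by omega)]
        intros
        omega
    · intro i m _
      rcases Nat.lt_or_ge (i+1) (n+1) with h | h
      · rw [e' (i+2) _ (by omega), e' (i+1) _ (by omega)]; exact G.B i m h
      · rw [e (i+1) _ h, e (i+2) _ (by omega)]
        intros
        omega

lemma exists_row_of_card_succ (c cp : YoungDiagram) (h1 : c ≤ cp)
    (hcard : cp.card = c.card + 1) :
    ∃ r, ∀ k, cp.rowLen k = c.rowLen k + if k = r then 1 else 0 := by
  classical
  have hsub : c.cells ⊆ cp.cells := cells_subset_iff.2 h1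
  have h2 : (cp.cells \ c.cells).card = 1 := by
    rw [Finset.card_sdiff_of_subset hsub]
    have : cp.cells.card = c.cells.card + 1 := hcard
    omega
  obtain ⟨⟨r, q⟩, hrq⟩ := Finset.card_eq_one.1 h2
  have hm : ∀ x y, (y < cp.rowLen x ∧ ¬ y < c.rowLen x) ↔ (x = r ∧ y = q) := by
    intro x y
    have := Finset.ext_iff.1 hrq (x, y)
    simpa [mem_iff_lt_rowLen] using this
  have hle : ∀ x, c.rowLen x ≤ cp.rowLen x := by
    intro x
    by_contra hlt
    have : (x, cp.rowLen x) ∈ c := mem_iff_lt_rowLen.2 (by omega)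
    have := mem_iff_lt_rowLen.1 (h1 this)
    omega
  refine ⟨r, fun k => ?_⟩
  have e0 := hle k
  have e1 := hm k (c.rowLen k)
  have e2 := hm k (c.rowLen k + 1)
  split_ifs with hk
  · have e3 := (hm k q).2 ⟨hk, rfl⟩
    omega
  · omega

lemma lr_aux (p q u v : Prop) [Decidable p] [Decidable q] [Decidable u] [Decidable v]
    (x y N : ℕ) (hxy : x ≤ y) (hpq : p → q) (huv : u → v) (hpu : p → u) (hqv : q → v)
    (h : q → ¬ p → u → x < y) :
    N + (if q ∧ ¬ p then 1 else 0) +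
      (y + (if v ∧ ¬ q then 1 else 0) - (x + (if u ∧ ¬ p then 1 else 0))) =
      N + (y - x) + (if v ∧ ¬ u then 1 else 0) := by
  by_cases a1 : p <;> by_cases a2 : q <;> by_cases a3 : u <;> by_cases a4 : v <;>
    simp [a1, a2, a3, a4] at * <;> omega

lemma LRChain.add_box {b c l cp : YoungDiagram} {L : ℕ → ℕ → ℕ} (H : LRChain b c l L)
    (r : ℕ) (hr : ∀ k, cp.rowLen k = c.rowLen k + if k = r then 1 else 0) :
    ∃ lp : YoungDiagram, l ≤ lp ∧ lp.card = l.card + 1 ∧ ∃ L', LRChain b cp lp L' := by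
  classical
  obtain ⟨S, n, G, hS⟩ := H.full_region r hr
  have s0 : ∀ m, ¬ S 0 m := (G 0).s0
  have sz : ∀ i, ¬ S i 0 := fun i => (G i).sz i le_rfl
  have up : ∀ i m, S i m → S i (m+1) := fun i m => (G i).up i m le_rfl
  have right : ∀ i m, S i m → S (i+1) m := fun i m => (G (i+1)).right i m (by omega)
  have slack : ∀ i k, S (i+1) (k+2) → ¬ S (i+1) (k+1) → lrN L (k+1) (i+1) < lrN L k i :=
    fun i k => (G (i+1)).slack i k (by omega)
  have GA : ∀ i m, S i (m+1) → ¬ S i m → S (i+1) m → L m i < L (m+1) i :=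
    fun i m => (G (i+1)).A i m (by omega)
  have GB : ∀ i m, S (i+2) (m+1) → ¬ S (i+1) (m+1) → L (m+1) (i+1) < L m i :=
    fun i m => (G (i+2)).B i m (by omega)
  have upm : ∀ i m m', m ≤ m' → S i m → S i m' := by
    intro i m m' h hs
    induction m', h using Nat.le_induction with
    | base => exact hs
    | succ m' _ ih => exact up i m' ih
  have rightm : ∀ m i i', i ≤ i' → S i m → S i' m := by
    intro m i i' h hs
    induction i', h using Nat.le_induction with
    | base => exact hs
    | succ m' _ ih => exact right m' m ih
  let L' : ℕ → ℕ → ℕ := fun m i => L m i + if S (i+1) m ∧ ¬ S i m then 1 else 0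
  have hL' : ∀ m i, L' m i = L m i + if S (i+1) m ∧ ¬ S i m then 1 else 0 := fun _ _ => rfl
  have A' : ∀ k i, L' k i ≤ L' (k+1) i := by
    intro k i
    rw [hL', hL']
    have h1 := H.A k i
    have h2 := GA i k
    have h3 := up (i+1) k
    have h4 := up i k
    split_ifs with a b
    · omega
    · have : L k i < L (k+1) i := by
        apply h2 _ a.2 a.1
        by_contra hc
        exact b ⟨h3 a.1, hc⟩
      omega
    · omega
    · omega
  have B' : ∀ k i, L' (k+1) (i+1) ≤ L' k i := by
    intro k i
    rw [hL' (k+1) (i+1)]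
    have h1 := H.B k i
    have h0 : L k i ≤ L' k i := by rw [hL']; omega
    split_ifs with a
    · have := GB i k a.1 a.2
      omega
    · omega
  have N' : ∀ k i, lrN L' k i = lrN L k i + if S i (k+1) ∧ ¬ S i k then 1 else 0 := by
    intro k i
    induction i with
    | zero => simp [lrN_zero, s0]
    | succ i ih =>
      rw [lrN_succ, lrN_succ, ih]
      rw [hL', hL']
      exact lr_aux _ _ _ _ _ _ _ (H.A k i) (up i k) (up (i+1) k) (right i k)
        (right i (k+1)) (GA i k)
  have C' : ∀ k i, lrN L' (k+1) (i+1) ≤ lrN L' k i := by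
    intro k i
    rw [N' (k+1)]
    have h1 := H.C k i
    have h0 : lrN L k i ≤ lrN L' k i := by rw [N']; omega
    split_ifs with a
    · have := slack i k a.1 a.2
      omega
    · omega
  have zero' : ∀ i, L' 0 i = b.rowLen i := by
    intro i
    rw [hL', H.zero, if_neg (fun h => sz _ h.1), add_zero]
  have content' : ∃ n, ∀ i, n ≤ i → ∀ k, lrN L' k i = cp.rowLen k := by
    obtain ⟨n', hn'⟩ := H.content
    refine ⟨max n n', fun i hi k => ?_⟩
    have e1 := hS i (by omega) (k+1)
    have e2 := hS i (by omega) k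
    rw [N', hn' i (by omega), hr]
    congr 1
    by_cases hkr : k = r
    · rw [if_pos hkr, if_pos ⟨e1.2 (by omega), fun h => by have := e2.1 h; omega⟩]
    · rw [if_neg hkr, if_neg]
      rintro ⟨h1, h2⟩
      have := e1.1 h1
      exact h2 (e2.2 (by omega))
  -- the row of the new box
  have hex : ∃ i, ∃ m, S (i+1) m := ⟨n, r+1, (hS (n+1) (by omega) _).2 le_rfl⟩
  obtain ⟨i0, hi1, hi2⟩ : ∃ i0, (∃ m, S (i0+1) m) ∧ ∀ m, ¬ S i0 m := by
    refine ⟨Nat.find hex, Nat.find_spec hex, fun m hm => ?_⟩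
    rcases hq : Nat.find hex with _ | q
    · rw [hq] at hm
      exact s0 m hm
    · rw [hq] at hm
      exact Nat.find_min hex (m := q) (by omega) ⟨m, hm⟩
  obtain ⟨m0, hm0⟩ := hi1
  have mono' : ∀ i, Monotone (fun k => L' k i) := fun i => monotone_nat_of_le_succ (fun k => A' k i)
  have reach : ∀ i, ∃ K, ∀ k, K ≤ k → L k i = l.rowLen i := by
    intro i
    rcases Nat.eq_zero_or_pos (l.rowLen i) with h | h
    · refine ⟨0, fun k _ => ?_⟩
      have := H.le_top k i
      omega
    · obtain ⟨K, hK⟩ := (H.top i (l.rowLen i - 1)).1 (by omega)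
      refine ⟨K, fun k hk => ?_⟩
      have h1 := H.mono i hk
      have h2 := H.le_top k i
      simp only at h1
      omega
  have top' : ∀ i j, (∃ k, j < L' k i) ↔ (j < l.rowLen i ∨ (i = i0 ∧ j = l.rowLen i0)) := by
    intro i j
    have hsup : ∃ K, ∀ k, K ≤ k → L' k i = l.rowLen i + if i = i0 then 1 else 0 := by
      obtain ⟨K, hK⟩ := reach i
      rcases lt_trichotomy i i0 with h | h | h
      · refine ⟨K, fun k hk => ?_⟩
        rw [hL', hK k hk, if_neg (show i ≠ i0 by omega), if_neg]
        rintro ⟨h1, _⟩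
        exact hi2 k (rightm k _ _ (by omega) h1)
      · subst h
        refine ⟨max K m0, fun k hk => ?_⟩
        rw [hL', hK k (by omega), if_pos rfl, if_pos]
        exact ⟨upm _ m0 k (by omega) hm0, hi2 k⟩
      · refine ⟨max K m0, fun k hk => ?_⟩
        rw [hL', hK k (by omega), if_neg (show i ≠ i0 by omega), if_neg]
        rintro ⟨_, h2⟩
        exact h2 (rightm k (i0+1) i (by omega) (upm _ m0 k (by omega) hm0))
    obtain ⟨K, hK⟩ := hsup
    have : (∃ k, j < L' k i) ↔ j < l.rowLen i + if i = i0 then 1 else 0 := by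
      constructor
      · rintro ⟨k, hk⟩
        have h1 := mono' i (le_max_left k K)
        simp only at h1
        rw [hK _ (le_max_right k K)] at h1
        omega
      · intro h
        exact ⟨K, by rw [hK K le_rfl]; exact h⟩
    rw [this]
    split_ifs with h
    · subst h
      omega
    · omega
  have hmem : ∀ i j, (i, j) ∈ insert (i0, l.rowLen i0) l.cells ↔ ∃ k, j < L' k i := by
    intro i j
    rw [top', Finset.mem_insert, mem_cells, mem_iff_lt_rowLen, Prod.mk.injEq]
    tauto
  have anti' : ∀ i j, (∃ k, j < L' k (i+1)) → ∃ k, j < L' k i := by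
    rintro i j ⟨k, hk⟩
    refine ⟨k, ?_⟩
    have := B' k i
    have := A' k (i+1)
    omega
  have anti'' : ∀ i i' j, i ≤ i' → (∃ k, j < L' k i') → ∃ k, j < L' k i := by
    intro i i' j h
    induction i', h using Nat.le_induction with
    | base => exact id
    | succ m _ ih => exact fun h => ih (anti' _ _ h)
  let lp : YoungDiagram := ⟨insert (i0, l.rowLen i0) l.cells, by
    rintro ⟨i, j⟩ ⟨i', j'⟩ hle hin
    obtain ⟨ha, hb⟩ := Prod.mk_le_mk.1 hle
    rw [Finset.mem_coe, hmem] at hin ⊢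
    obtain ⟨k, hk⟩ := anti'' _ _ _ ha hin
    exact ⟨k, by omega⟩⟩
  refine ⟨lp, ?_, ?_, L', zero', ?_, A', B', C', content'⟩
  · exact cells_subset_iff.1 (Finset.subset_insert _ _)
  · change (insert (i0, l.rowLen i0) l.cells).card = l.cells.card + 1
    apply Finset.card_insert_of_notMem
    rw [mem_cells, mem_iff_lt_rowLen]
    omega
  · intro i j
    rw [← hmem, ← mem_iff_lt_rowLen, ← mem_cells]

/-- If `c^lam_{β,γ} > 0` and `γ⁺ ⊃ γ` with one box added, then there
exists `lam⁺ ⊃ lam` with one box added such that `c^{lam⁺}_{β,γ⁺} > 0`. -/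
theorem lr_add_box_content (β γ lam γp : YoungDiagram) (h : 0 < lrCoeff β γ lam)
    (h1 : γ ≤ γp) (hcard : γp.card = γ.card + 1) :
    ∃ lamp : YoungDiagram, lam ≤ lamp ∧ lamp.card = lam.card + 1 ∧
      0 < lrCoeff β γp lamp := by
  obtain ⟨F⟩ : Nonempty (LRFilling β γ lam) := (Nat.card_pos_iff.1 h).1
  obtain ⟨L, H⟩ := F.exists_chain
  obtain ⟨r, hr⟩ := exists_row_of_card_succ γ γp h1 hcard
  obtain ⟨lp, hle, hc, L', H'⟩ := H.add_box r hr
  exact ⟨lp, hle, hc, Nat.card_pos_iff.2 ⟨H'.nonempty, lr_finite _ _ _⟩⟩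
end

section
/- If c^μ_{α,β} > 0 and α⁻ ⊂ α with |α/α⁻| = 1 (one box removed from α), then there exists β⁺ ⊃ β with |β⁺/β| = 1 such that c^μ_{α⁻,β⁺} > 0. -/
open YoungDiagram

/-- Reading order: rows top to bottom, each row right to left. -/
def bf (p q : ℕ × ℕ) : Prop := p.1 < q.1 ∨ (p.1 = q.1 ∧ q.2 < p.2)

theorem bf_first (s : Finset (ℕ × ℕ)) (hs : s.Nonempty) :
    ∃ q ∈ s, ∀ q' ∈ s, q' = q ∨ bf q q' := by
  obtain ⟨q, hq, hmin⟩ := Finset.exists_min_image s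
    (fun q => toLex (q.1, OrderDual.toDual q.2)) hs
  refine ⟨q, hq, fun q' hq' => ?_⟩
  have := hmin q' hq'
  rw [Prod.Lex.toLex_le_toLex] at this
  simp only [OrderDual.toDual_le_toDual] at this
  unfold bf
  rcases this with h | ⟨h, h'⟩
  · right; left; exact h
  · rcases Nat.lt_or_eq_of_le h' with h'' | h''
    · right; right; exact ⟨h, h''⟩
    · left; exact Prod.ext h.symm h''

open Classical in
theorem card_eq_sum_s13 (s : Finset (ℕ × ℕ)) (P : ℕ × ℕ → Prop) (hP : ∀ q, P q → q ∈ s) :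
    Nat.card {q // P q} = ∑ q ∈ s, if P q then 1 else 0 := by
  rw [Finset.sum_boole, Nat.cast_id]
  rw [← Nat.card_eq_finsetCard]
  refine Nat.card_congr (Equiv.subtypeEquivRight fun q => ?_)
  simp only [Finset.mem_filter]
  exact ⟨fun h => ⟨hP q h, h⟩, fun h => h.2⟩

/-- The bumping path. -/
theorem path_exists (s : Finset (ℕ × ℕ)) (T : ℕ → ℕ → ℕ) (hT : ∀ i j, T i j ≠ 0 → (i, j) ∈ s)
    (x : ℕ × ℕ) (hx : T x.1 x.2 = 0) :
    ∃ (m : ℕ) (p : ℕ → ℕ × ℕ), p 0 = x ∧ (∀ k ≤ m, T (p k).1 (p k).2 = k) ∧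
      (∀ k < m, bf (p k) (p (k + 1)) ∧
        ∀ q, bf (p k) q → T q.1 q.2 = k + 1 → q = p (k + 1) ∨ bf (p (k + 1)) q) ∧
      ∀ q, bf (p m) q → T q.1 q.2 ≠ m + 1 := by
  classical
  have h1 : ∀ (k : ℕ) (a : ℕ × ℕ), ∃ b, (∃ q, bf a q ∧ T q.1 q.2 = k + 1) →
      (bf a b ∧ T b.1 b.2 = k + 1) ∧
        ∀ q, bf a q → T q.1 q.2 = k + 1 → q = b ∨ bf b q := by
    intro k a
    by_cases h : ∃ q, bf a q ∧ T q.1 q.2 = k + 1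
    · obtain ⟨q, hq, hq'⟩ := h
      obtain ⟨b, hb, hb'⟩ := bf_first (s.filter fun q => bf a q ∧ T q.1 q.2 = k + 1)
        ⟨q, by
          rw [Finset.mem_filter]
          exact ⟨hT q.1 q.2 (by omega), hq, hq'⟩⟩
      rw [Finset.mem_filter] at hb
      refine ⟨b, fun _ => ⟨hb.2, fun q h1 h2 => hb' q ?_⟩⟩
      rw [Finset.mem_filter]
      exact ⟨hT q.1 q.2 (by omega), h1, h2⟩
    · exact ⟨a, fun h' => absurd h' h⟩
  choose next hnext using h1
  let p : ℕ → ℕ × ℕ := fun n => Nat.rec x (fun k a => next k a) n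
  have hp : ∀ k, p (k + 1) = next k (p k) := fun k => rfl
  have hex : ∃ m, ¬ ∃ q, bf (p m) q ∧ T q.1 q.2 = m + 1 := by
    refine ⟨s.sup (fun q => T q.1 q.2), ?_⟩
    rintro ⟨q, -, hq⟩
    have := Finset.le_sup (f := fun q : ℕ × ℕ => T q.1 q.2) (hT q.1 q.2 (by omega))
    simp only at this
    omega
  have hlt : ∀ k < Nat.find hex, ∃ q, bf (p k) q ∧ T q.1 q.2 = k + 1 := fun k hk =>
    not_not.1 (Nat.find_min hex hk)
  refine ⟨Nat.find hex, p, rfl, ?_, ?_, ?_⟩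
  · intro k hk
    cases k with
    | zero => exact hx
    | succ k =>
      rw [hp]
      exact (hnext k (p k) (hlt k hk)).1.2
  · intro k hk
    rw [hp]
    exact ⟨(hnext k (p k) (hlt k hk)).1.1, (hnext k (p k) (hlt k hk)).2⟩
  · intro q h1 h2
    exact Nat.find_spec hex ⟨q, h1, h2⟩

theorem lr_finite_s13 (μ ν lam : YoungDiagram) : Finite (LRFilling μ ν lam) := by
  classical
  have hb : ∀ (F : LRFilling μ ν lam) (i j : ℕ), F.T i j < ν.colLen 0 + 1 := by
    intro F i j
    rcases Nat.eq_zero_or_pos (F.T i j) with h | h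
    · omega
    · obtain ⟨k, hk⟩ : ∃ k, F.T i j = k + 1 := ⟨F.T i j - 1, by omega⟩
      have h2 := F.content k
      have hs : ∀ q : ℕ × ℕ, F.T q.1 q.2 = k + 1 → q ∈ lam.cells := fun q hq =>
        ((F.supp q.1 q.2).1 (by omega)).1
      have : Finite {p : ℕ × ℕ // F.T p.1 p.2 = k + 1} :=
        Set.Finite.subset (lam.cells.finite_toSet) hs
      have : 0 < Nat.card {p : ℕ × ℕ // F.T p.1 p.2 = k + 1} :=
        Nat.card_pos_iff.2 ⟨⟨⟨(i, j), hk⟩⟩, this⟩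
      rw [h2] at this
      have h3 := YoungDiagram.mem_iff_lt_rowLen.2 this
      have h4 := YoungDiagram.mem_iff_lt_colLen.1 h3
      omega
  refine Finite.of_injective (β := lam.cells → Fin (ν.colLen 0 + 1))
    (fun F q => ⟨F.T q.1.1 q.1.2, hb F _ _⟩) ?_
  intro F G h
  have : F.T = G.T := by
    funext i j
    by_cases hm : (i, j) ∈ lam
    · have := congrFun h ⟨(i, j), hm⟩
      simpa using this
    · have h1 : F.T i j = 0 := by
        by_contra h; exact hm ((F.supp i j).1 h).1
      have h2 : G.T i j = 0 := by
        by_contra h; exact hm ((G.supp i j).1 h).1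
      rw [h1, h2]
  cases F; cases G; simp only at this; subst this; rfl

/-- Adding a box at the end of row `m`. -/
theorem add_box (β : YoungDiagram) (m : ℕ)
    (h : ∀ k, m = k + 1 → β.rowLen m < β.rowLen k) :
    ∃ βp : YoungDiagram, β ≤ βp ∧ βp.card = β.card + 1 ∧
      ∀ k, βp.rowLen k = β.rowLen k + if k = m then 1 else 0 := by
  have hn : (m, β.rowLen m) ∉ β.cells := by
    intro h; exact lt_irrefl _ (YoungDiagram.mem_iff_lt_rowLen.1 h)
  have hlow : IsLowerSet (↑(insert (m, β.rowLen m) β.cells) : Set (ℕ × ℕ)) := by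
    rintro ⟨a1, a2⟩ ⟨b1, b2⟩ hab ha
    obtain ⟨h1, h2⟩ : b1 ≤ a1 ∧ b2 ≤ a2 := hab
    simp only [Finset.coe_insert, Set.mem_insert_iff, Finset.mem_coe, Prod.mk.injEq,
      YoungDiagram.mem_cells] at ha ⊢
    rcases ha with ⟨rfl, rfl⟩ | ha
    · rcases Nat.lt_or_eq_of_le h1 with h3 | h3
      · right
        obtain ⟨k, hk⟩ : ∃ k, a1 = k + 1 := ⟨a1 - 1, by omega⟩
        have h4 := h k hk
        have h5 := β.rowLen_anti b1 k (by omega)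
        rw [YoungDiagram.mem_iff_lt_rowLen]
        omega
      · subst h3
        rcases Nat.lt_or_eq_of_le h2 with h3 | h3
        · right; rwa [YoungDiagram.mem_iff_lt_rowLen]
        · left; exact ⟨rfl, h3⟩
    · right
      exact β.up_left_mem h1 h2 ha
  refine ⟨⟨insert (m, β.rowLen m) β.cells, hlow⟩, ?_, ?_, ?_⟩
  · intro q hq
    exact Finset.mem_insert_of_mem hq
  · exact Finset.card_insert_of_notMem hn
  · intro k
    have key : ∀ j, j < YoungDiagram.rowLen ⟨insert (m, β.rowLen m) β.cells, hlow⟩ k ↔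
        j < β.rowLen k + if k = m then 1 else 0 := by
      intro j
      rw [← YoungDiagram.mem_iff_lt_rowLen, ← YoungDiagram.mem_cells]
      simp only [Finset.mem_insert, Prod.mk.injEq, YoungDiagram.mem_cells]
      rw [YoungDiagram.mem_iff_lt_rowLen]
      by_cases hk : k = m
      · subst hk; simp; omega
      · simp [hk]
    have a := key (β.rowLen k + if k = m then 1 else 0)
    have b := key (YoungDiagram.rowLen ⟨insert (m, β.rowLen m) β.cells, hlow⟩ k)
    omega

theorem corner_exists (α αm : YoungDiagram) (h1 : αm ≤ α) (hcard : αm.card + 1 = α.card) :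
    ∃ x : ℕ × ℕ, x ∉ αm ∧ ∀ q, q ∈ α ↔ q = x ∨ q ∈ αm := by
  have hsub : αm.cells ⊆ α.cells := h1
  have hc : (α.cells \ αm.cells).card = 1 := by
    rw [Finset.card_sdiff_of_subset hsub]
    unfold YoungDiagram.card at hcard
    omega
  obtain ⟨x, hx⟩ := Finset.card_eq_one.1 hc
  have hx' : ∀ q, (q ∈ α ∧ q ∉ αm) ↔ q = x := by
    intro q
    have : q ∈ α.cells \ αm.cells ↔ q ∈ ({x} : Finset (ℕ × ℕ)) := by rw [hx]
    simpa using this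
  refine ⟨x, ((hx' x).2 rfl).2, fun q => ?_⟩
  have := hx' q
  have h2 : q ∈ αm → q ∈ α := fun h => hsub h
  tauto

/-- If `c^μ_{α,β} > 0` and `α⁻ ⊂ α` with one box removed from `α`, then
there exists `β⁺ ⊃ β` with one box added such that `c^μ_{α⁻,β⁺} > 0`. -/
theorem lr_remove_box_inner (μ α β αm : YoungDiagram) (h : 0 < lrCoeff α β μ)
    (h1 : αm ≤ α) (hcard : αm.card + 1 = α.card) :
    ∃ βp : YoungDiagram, β ≤ βp ∧ βp.card = β.card + 1 ∧ 0 < lrCoeff αm βp μ := by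
  classical
  obtain ⟨⟨F⟩, -⟩ := Nat.card_pos_iff.1 h
  obtain ⟨x, hxm, hα⟩ := corner_exists α αm h1 hcard
  have hxα : x ∈ α := (hα x).2 (Or.inl rfl)
  obtain ⟨hsub, T, supp, rows, cols, content, ballot⟩ := F
  have hTμ : ∀ i j, T i j ≠ 0 → (i, j) ∈ μ.cells := fun i j h => ((supp i j).1 h).1
  have hTα : ∀ q : ℕ × ℕ, q ∈ α → T q.1 q.2 = 0 := by
    intro q hq
    by_contra h
    exact ((supp q.1 q.2).1 h).2 hq
  have hx0 : T x.1 x.2 = 0 := hTα x hxα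
  obtain ⟨m, p, hp0, hpT, hstep, hend⟩ := path_exists μ.cells T hTμ x hx0
  -- no cell to the right of `p k` in its row has value `k`
  have hright : ∀ k ≤ m, ∀ j, (p k).2 < j → ((p k).1, j) ∈ μ → T (p k).1 j ≠ k := by
    intro k hk j hj hjm hT
    cases k with
    | zero =>
      rw [hp0] at hj hjm hT
      have : (x.1, j) ∉ α := by
        intro h
        rcases (hα _).1 h with h | h
        · rw [← h] at hj; simp at hj
        · exact hxm (αm.up_left_mem le_rfl hj.le h)
      exact (supp x.1 j).2 ⟨hjm, this⟩ hT
    | succ k =>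
      have hb := hstep k (by omega)
      have hTk := hpT k (by omega)
      have hTk1 := hpT (k + 1) hk
      have hc := hb.2 ((p (k + 1)).1, j)
      have hb1 := hb.1
      have e : p k = ((p k).1, (p k).2) := rfl
      have h2 : ¬ bf (p k) ((p (k + 1)).1, j) := by
        intro h
        rcases hc h hT with h | h
        · rw [← h] at hj; simp at hj
        · unfold bf at h; simp only at h; omega
      unfold bf at h2 hb1
      simp only at h2
      have hrow : (p k).1 = (p (k + 1)).1 := by omega
      have hcol : (p (k + 1)).2 < (p k).2 := by omega
      rw [hrow] at hTk
      by_cases hk0 : k = 0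
      · subst hk0
        rw [hp0] at hrow hcol
        have : ((p 1).1, (p 1).2) ∈ α := by
          refine α.up_left_mem (i2 := x.1) (j2 := x.2) ?_ hcol.le hxα
          simp only [zero_add] at hrow
          omega
        have := hTα _ this
        simp only [zero_add] at hTk1 this
        omega
      · have := rows (p (k + 1)).1 (p (k + 1)).2 (p k).2 hcol.le (by omega) (by omega)
        omega
  -- the new filling
  let S : ℕ → ℕ → ℕ := fun i j => if T i j ≤ m ∧ (i, j) = p (T i j) then T i j + 1 else T i j
  have hS : ∀ i j, S i j = if T i j ≤ m ∧ (i, j) = p (T i j) then T i j + 1 else T i j :=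
    fun i j => rfl
  have hSsupp : ∀ i j, S i j ≠ 0 ↔ (i, j) ∈ μ ∧ (i, j) ∉ αm := by
    intro i j
    have hs := supp i j
    have ha := hα (i, j)
    by_cases hx : (i, j) = x
    · have h0 : T i j = 0 := by rw [← hx] at hx0; exact hx0
      have : S i j = 1 := by
        rw [hS, h0, if_pos ⟨Nat.zero_le _, by rw [hp0, hx]⟩]
      rw [this, hx]
      exact ⟨fun _ => ⟨hsub hxα, hxm⟩, fun _ => one_ne_zero⟩
    · have : S i j ≠ 0 ↔ T i j ≠ 0 := by
        rw [hS]
        split_ifs with hc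
        · have : T i j ≠ 0 := by
            intro h0; rw [h0, hp0] at hc; exact hx hc.2
          simp [this]
        · rfl
      rw [this, hs, ha]
      tauto
  have hTzero : ∀ i j, T i j = 0 → S i j ≠ 0 → (i, j) = x := by
    intro i j h0 h1
    rw [hS] at h1
    split_ifs at h1 with hc
    · rw [h0, hp0] at hc; exact hc.2
    · exact absurd h0 h1
  -- counting
  have hcount : ∀ (Q : ℕ × ℕ → Prop) (k : ℕ),
      Nat.card {q : ℕ × ℕ // Q q ∧ S q.1 q.2 = k + 1} +
        (if Q (p (k + 1)) ∧ k + 1 ≤ m then 1 else 0) =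
      Nat.card {q : ℕ × ℕ // Q q ∧ T q.1 q.2 = k + 1} +
        (if Q (p k) ∧ k ≤ m then 1 else 0) := by
    intro Q k
    have hpμ : ∀ k ≤ m, p k ∈ μ.cells := by
      intro k hk
      by_cases hk0 : k = 0
      · subst hk0; rw [hp0]; exact hsub hxα
      · exact hTμ _ _ (by rw [hpT k hk]; exact hk0)
    have aux : ∀ k, (if Q (p k) ∧ k ≤ m then 1 else 0) =
        ∑ q ∈ μ.cells, if q = p k then (if Q (p k) ∧ k ≤ m then 1 else 0) else 0 := by
      intro k
      rw [Finset.sum_ite_eq']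
      by_cases hk : k ≤ m
      · rw [if_pos (hpμ k hk)]
      · simp [hk]
    rw [card_eq_sum_s13 μ.cells _ (fun q hq => ((hSsupp q.1 q.2).1 (by omega)).1),
      card_eq_sum_s13 μ.cells _ (fun q hq => hTμ q.1 q.2 (by omega)), aux k, aux (k + 1),
      ← Finset.sum_add_distrib, ← Finset.sum_add_distrib]
    refine Finset.sum_congr rfl fun q _ => ?_
    have hSq := hS q.1 q.2
    have e : ((q.1, q.2) : ℕ × ℕ) = q := rfl
    rw [e] at hSq
    by_cases hQ : Q q
    · by_cases h1 : q = p k ∧ k ≤ m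
      · have ht : T q.1 q.2 = k := by rw [h1.1]; exact hpT k h1.2
        have hs : S q.1 q.2 = k + 1 := by rw [hSq, ht, if_pos ⟨h1.2, h1.1⟩]
        have hne : q ≠ p (k + 1) ∨ ¬ (k + 1 ≤ m) := by
          by_contra hcon
          push Not at hcon
          have := hpT (k + 1) hcon.2
          rw [← hcon.1] at this
          omega
        have hQ' := hQ
        rw [h1.1] at hQ'
        rcases hne with hne | hne
        · simp [hQ, ht, hs, hne, ← h1.1, h1.2]
        · simp [hQ, ht, hs, hne, ← h1.1, h1.2]
      · have e1 : (if q = p k then (if Q (p k) ∧ k ≤ m then 1 else 0) else 0) = 0 := by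
          split_ifs <;> tauto
        rw [e1]
        by_cases h2 : q = p (k + 1) ∧ k + 1 ≤ m
        · have ht : T q.1 q.2 = k + 1 := by rw [h2.1]; exact hpT _ h2.2
          have hs : S q.1 q.2 = k + 1 + 1 := by rw [hSq, ht, if_pos ⟨h2.2, h2.1⟩]
          simp [hQ, ht, hs, ← h2.1, h2.2]
        · have e2 : (if q = p (k + 1) then (if Q (p (k + 1)) ∧ k + 1 ≤ m then 1 else 0) else 0)
              = 0 := by
            split_ifs <;> tauto
          rw [e2]
          have : S q.1 q.2 = k + 1 ↔ T q.1 q.2 = k + 1 := by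
            rw [hSq]
            split_ifs with hc
            · constructor
              · intro h
                have : T q.1 q.2 = k := by omega
                rw [this] at hc
                exact absurd ⟨hc.2, hc.1⟩ h1
              · intro h
                rw [h] at hc
                exact absurd ⟨hc.2, hc.1⟩ h2
            · rfl
          by_cases ht : T q.1 q.2 = k + 1 <;> simp [this, ht, hQ]
    · have e1 : ∀ k, (if q = p k then (if Q (p k) ∧ k ≤ m then 1 else 0) else 0) = 0 := by
        intro k
        split_ifs with ha hb
        · rw [← ha] at hb; exact absurd hb.1 hQ
        · rfl
        · rfl
      rw [e1, e1]
      simp [hQ]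
  -- strictness between consecutive path cells
  have hstrict : ∀ i j k, k + 1 ≤ m →
      ((p (k + 1)).1 < i ∨ ((p (k + 1)).1 = i ∧ j ≤ (p (k + 1)).2)) →
      ¬ (((p (k + 2)).1 < i ∨ ((p (k + 2)).1 = i ∧ j ≤ (p (k + 2)).2)) ∧ k + 2 ≤ m) →
      Nat.card {q : ℕ × ℕ // (q.1 < i ∨ (q.1 = i ∧ j ≤ q.2)) ∧ T q.1 q.2 = k + 2} + 1 ≤
      Nat.card {q : ℕ × ℕ // (q.1 < i ∨ (q.1 = i ∧ j ≤ q.2)) ∧ T q.1 q.2 = k + 1} := by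
    intro i j k hk hin hout
    have hpk := hpT (k + 1) hk
    have hb := ballot (p (k + 1)).1 ((p (k + 1)).2 + 1) k
    have hfin : ∀ (Q : ℕ × ℕ → Prop) (k : ℕ), {q : ℕ × ℕ | Q q ∧ T q.1 q.2 = k + 1}.Finite :=
      fun Q k => Set.Finite.subset μ.cells.finite_toSet
        (fun q hq => hTμ q.1 q.2 (by have := hq.2; omega))
    have s1 : Nat.card {q : ℕ × ℕ // (q.1 < i ∨ (q.1 = i ∧ j ≤ q.2)) ∧ T q.1 q.2 = k + 2} ≤
        Nat.card {q : ℕ × ℕ // (q.1 < (p (k + 1)).1 ∨ (q.1 = (p (k + 1)).1 ∧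
          (p (k + 1)).2 + 1 ≤ q.2)) ∧ T q.1 q.2 = k + 2} := by
      refine Nat.card_mono (hfin _ (k + 1)) ?_
      rintro q ⟨hq1, hq2⟩
      refine ⟨?_, hq2⟩
      by_contra hcon
      have hne : ¬ (q.1 = (p (k + 1)).1 ∧ q.2 = (p (k + 1)).2) := by
        rintro ⟨h1, h2⟩
        rw [h1, h2] at hq2
        omega
      have hbf : bf (p (k + 1)) q := by unfold bf; omega
      by_cases hkm : k + 2 ≤ m
      · have := (hstep (k + 1) (by omega)).2 q hbf hq2
        apply hout
        refine ⟨?_, hkm⟩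
        rcases this with h | h
        · rw [h] at hq1; exact hq1
        · unfold bf at h
          have e : p (k + 1 + 1) = p (k + 2) := rfl
          rw [e] at h
          omega
      · have : m = k + 1 := by omega
        subst this
        exact hend q hbf hq2
    have s2 : Nat.card {q : ℕ × ℕ // (q.1 < (p (k + 1)).1 ∨ (q.1 = (p (k + 1)).1 ∧
          (p (k + 1)).2 + 1 ≤ q.2)) ∧ T q.1 q.2 = k + 1} + 1 ≤
        Nat.card {q : ℕ × ℕ // (q.1 < i ∨ (q.1 = i ∧ j ≤ q.2)) ∧ T q.1 q.2 = k + 1} := by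
      refine Nat.succ_le_of_lt ?_
      refine Set.ncard_lt_ncard ?_ (hfin (fun q => q.1 < i ∨ (q.1 = i ∧ j ≤ q.2)) k)
      refine (Set.ssubset_iff_of_subset ?_).2 ⟨p (k + 1), ⟨hin, hpk⟩, ?_⟩
      · rintro q ⟨hq1, hq2⟩
        exact ⟨by omega, hq2⟩
      · rintro ⟨hq1, hq2⟩
        omega
    omega
  have hcontT : ∀ k, Nat.card {q : ℕ × ℕ // True ∧ T q.1 q.2 = k + 1} = β.rowLen k := by
    intro k
    rw [← content k]
    simp only [true_and]
  have htot : ∀ k, Nat.card {q : ℕ × ℕ // (q.1 < (μ.colLen 0 + (p m).1 + 1) ∨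
      (q.1 = (μ.colLen 0 + (p m).1 + 1) ∧ 0 ≤ q.2)) ∧ T q.1 q.2 = k + 1} = β.rowLen k := by
    intro k
    rw [← content k]
    refine Nat.card_congr (Equiv.subtypeEquivRight fun q => ?_)
    refine ⟨fun h => h.2, fun h => ⟨?_, h⟩⟩
    have h1 : (q.1, q.2) ∈ μ := hTμ q.1 q.2 (by omega)
    have h2 : (q.1, 0) ∈ μ := μ.up_left_mem le_rfl (Nat.zero_le _) h1
    have := YoungDiagram.mem_iff_lt_colLen.1 h2
    omega
  obtain ⟨βp, hβ1, hβ2, hβ3⟩ := add_box β m (by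
    intro k hk
    have := hstrict (μ.colLen 0 + (p m).1 + 1) 0 k hk.ge (by rw [← hk]; omega) (by omega)
    rw [htot k] at this
    have h2 := htot (k + 1)
    rw [h2] at this
    rw [hk]
    omega)
  refine ⟨βp, hβ1, hβ2, ?_⟩
  have := lr_finite_s13 αm βp μ
  refine Nat.card_pos_iff.2 ⟨⟨⟨h1.trans hsub, S, hSsupp, ?_, ?_, ?_, ?_⟩⟩, this⟩
  · intro i j₁ j₂ hj hS1 hS2
    have hm1 := (hSsupp i j₁).1 hS1
    have hm2 := (hSsupp i j₂).1 hS2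
    rcases Nat.lt_or_eq_of_le hj with hj' | hj'
    swap
    · rw [hj']
    have hle : T i j₁ ≤ T i j₂ := by
      by_cases h0 : T i j₁ = 0
      · omega
      by_cases h0' : T i j₂ = 0
      · have hx := hTzero i j₂ h0' hS2
        have : (i, j₁) ∈ α := α.up_left_mem le_rfl hj (by rw [hx]; exact hxα)
        exact absurd (hTα _ this) h0
      exact rows i j₁ j₂ hj h0 h0'
    by_cases hc : T i j₁ ≤ m ∧ (i, j₁) = p (T i j₁)
    · have hr := hright _ hc.1 j₂
      rw [← hc.2] at hr
      have hne := hr hj' hm2.1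
      simp only at hne
      rw [hS i j₁, if_pos hc, hS i j₂]
      split_ifs <;> omega
    · rw [hS i j₁, if_neg hc, hS i j₂]
      split_ifs <;> omega
  · intro i₁ i₂ j hi hS1 hS2
    have hm1 := (hSsupp i₁ j).1 hS1
    have hm2 := (hSsupp i₂ j).1 hS2
    -- cells strictly below a cell outside `αm` are outside `α`
    have hbelow : ∀ i, i₁ < i → (i, j) ∈ μ → T i j ≠ 0 := by
      intro i hi hmem
      refine (supp i j).2 ⟨hmem, fun h => ?_⟩
      rcases (hα _).1 h with h | h
      · have hin : (i₁, j) ∈ α := α.up_left_mem hi.le le_rfl (by rw [h]; exact hxα)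
        rcases (hα _).1 hin with h' | h'
        · rw [← h] at h'; simp at h'; omega
        · exact hm1.2 h'
      · exact hm1.2 (αm.up_left_mem hi.le le_rfl h)
    have hlt : ∀ i, i₁ < i → (i, j) ∈ μ → T i₁ j < T i j := by
      intro i hi hmem
      by_cases h0 : T i₁ j = 0
      · have := hbelow i hi hmem; omega
      · exact cols i₁ i j hi h0 (hbelow i hi hmem)
    have hl := hlt i₂ hi hm2.1
    by_cases hc : T i₁ j ≤ m ∧ (i₁, j) = p (T i₁ j)
    swap
    · rw [hS i₁ j, if_neg hc, hS i₂ j]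
      split_ifs <;> omega
    rw [hS i₁ j, if_pos hc, hS i₂ j]
    split_ifs with hc2
    · omega
    by_contra hcon
    have hk : T i₂ j = T i₁ j + 1 := by omega
    -- adjacent rows
    have hadj : i₂ = i₁ + 1 := by
      by_contra hne
      have hmem : (i₁ + 1, j) ∈ μ := μ.up_left_mem (by omega) le_rfl hm2.1
      have h3 := hlt (i₁ + 1) (by omega) hmem
      have h4 := cols (i₁ + 1) i₂ j (by omega) (by omega) (by omega)
      omega
    generalize hkk : T i₁ j = k at *
    have hbf : bf (p k) (i₂, j) := by
      rw [← hc.2]; unfold bf; simp only; omega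
    by_cases hkm : k = m
    · subst hkm
      exact hend _ hbf hk
    have hkm' : k + 1 ≤ m := by omega
    have hst := hstep k (by omega)
    have hT1 := hpT (k + 1) hkm'
    rcases hst.2 _ hbf hk with h | h
    · apply hc2
      rw [hk]
      exact ⟨hkm', h⟩
    · have hb1 := hst.1
      rw [← hc.2] at hb1
      have hr := hright k hc.1
      rw [← hc.2] at hr
      unfold bf at hb1 h
      simp only at hb1 h hr
      have hmem : ((p (k + 1)).1, (p (k + 1)).2) ∈ μ := hTμ _ _ (by omega)
      by_cases hrow : (p (k + 1)).1 = i₁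
      · have hcol : (p (k + 1)).2 < j := by omega
        rw [hrow] at hT1
        by_cases hk0 : k = 0
        · have hx : (i₁, j) = x := by rw [hc.2, hk0, hp0]
          have : (i₁, (p (k + 1)).2) ∈ α :=
            α.up_left_mem le_rfl hcol.le (by rw [hx]; exact hxα)
          have := hTα _ this
          simp only at this
          omega
        · have := rows i₁ (p (k + 1)).2 j hcol.le (by omega) (by omega)
          omega
      · have hrow2 : (p (k + 1)).1 = i₂ := by omega
        have hcol : j < (p (k + 1)).2 := by omega
        rw [hrow2] at hT1 hmem
        have hmem1 : (i₁, (p (k + 1)).2) ∈ μ := μ.up_left_mem hi.le le_rfl hmem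
        have hne := hr _ hcol hmem1
        have hnα : (i₁, (p (k + 1)).2) ∉ α := by
          intro hmα
          rcases (hα _).1 hmα with h' | h'
          · have : (i₁, j) ∈ α := α.up_left_mem le_rfl hcol.le hmα
            rcases (hα _).1 this with h'' | h''
            · rw [← h'] at h''
              simp only [Prod.mk.injEq, true_and] at h''
              omega
            · exact hm1.2 h''
          · exact hm1.2 (αm.up_left_mem le_rfl hcol.le h')
        have hn0 := (supp _ _).2 ⟨hmem1, hnα⟩
        have h5 := cols i₁ i₂ _ hi hn0 (by omega)
        by_cases hk0 : k = 0
        · omega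
        · have := rows i₁ j (p (k + 1)).2 hcol.le (by omega) hn0
          omega
  · intro k
    have h1 := hcount (fun _ => True) k
    have h2 := hcontT k
    simp only [true_and] at h1 h2
    rw [hβ3 k]
    rw [h2] at h1
    split_ifs at h1 ⊢ <;> omega
  · intro i j k
    have c1 := hcount (fun q => q.1 < i ∨ (q.1 = i ∧ j ≤ q.2)) k
    have c2 := hcount (fun q => q.1 < i ∨ (q.1 = i ∧ j ≤ q.2)) (k + 1)
    have hb := ballot i j k
    have hs := hstrict i j k
    simp only [add_assoc, Nat.reduceAdd] at c1 c2
    have hmon : k + 1 ≤ m → ((p (k + 1)).1 < i ∨ ((p (k + 1)).1 = i ∧ j ≤ (p (k + 1)).2)) →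
        ((p k).1 < i ∨ ((p k).1 = i ∧ j ≤ (p k).2)) := by
      intro hk hin
      have := (hstep k (by omega)).1
      unfold bf at this
      omega
    by_cases q1 : ((p (k + 1)).1 < i ∨ ((p (k + 1)).1 = i ∧ j ≤ (p (k + 1)).2)) ∧ k + 1 ≤ m
    · rw [if_pos q1] at c1 c2
      rw [if_pos ⟨hmon q1.2 q1.1, by omega⟩] at c1
      by_cases q2 : ((p (k + 2)).1 < i ∨ ((p (k + 2)).1 = i ∧ j ≤ (p (k + 2)).2)) ∧ k + 2 ≤ m
      · rw [if_pos q2] at c2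
        omega
      · rw [if_neg q2] at c2
        have := hs q1.2 q1.1 q2
        omega
    · rw [if_neg q1] at c1 c2
      split_ifs at c1 c2 <;> omega
end
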